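/- There exist constants δ, D > 0 and a positive integer Q such that the following holds for Thompson's group T. For every g ∈ T with N(g) ≥ 4 there is a word w in the letters {x0^{±1}, x1^{±1}, c1^{±1}} of length at most D·|g|_B such that g·w = x0^{Q·|g|_B}·x1^{−1}·x0^{−Q·|g|_B+1} as elements of T, and for every prefix w' of w (evaluated as an element of T) one has |g·w'|_B > δ·|g|_B. -/

import Mathlib

/-!
Formalization framework for Thompson's groups `F ≤ T ≤ V` acting on the
Cantor set `{0,1}^ℕ`.  Elements of `V` are permutations of the Cantor set
admitting a finite table of branches `u → v` (complete prefix codes) with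
`g(uω) = vω`.  Products in the paper are composed left-to-right, i.e. the
paper's `g·h` is `Equiv.trans g h` (equivalently `h * g` in `Equiv.Perm`).
-/

abbrev CSeq : Type := ℕ → Bool
abbrev VPerm : Type := Equiv.Perm CSeq

/-- Concatenation of a finite binary word with an infinite binary word. -/
def app (u : List Bool) (ω : CSeq) : CSeq := fun n =>
  if h : n < u.length then u[n] else ω (n - u.length)

/-- The finite word `u` is a prefix of the infinite word `ω`. -/
def IsPref (u : List Bool) (ω : CSeq) : Prop := ∃ ω', ω = app u ω'

/-- The finite table of branches `T` represents the permutation `g` of the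
Cantor set: the domain codes and the range codes each form a complete prefix
code, and `g` maps `uω ↦ vω` for every branch `(u, v) ∈ T`. -/
def Represents (g : VPerm) (T : Finset (List Bool × List Bool)) : Prop :=
  (∀ ω : CSeq, ∃! p : List Bool × List Bool, p ∈ T ∧ IsPref p.1 ω) ∧
  (∀ ω : CSeq, ∃! p : List Bool × List Bool, p ∈ T ∧ IsPref p.2 ω) ∧
  (∀ p ∈ T, ∀ ω : CSeq, g (app p.1 ω) = app p.2 ω)

/-- A table of branches is reduced if it contains no pair of branches
`u0 → v0`, `u1 → v1`. -/
def Reduced (T : Finset (List Bool × List Bool)) : Prop :=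
  ∀ u v : List Bool,
    ¬((u ++ [false], v ++ [false]) ∈ T ∧ (u ++ [true], v ++ [true]) ∈ T)

/-- Membership in Thompson's group `V`. -/
def InV (g : VPerm) : Prop := ∃ T, Represents g T

/-- `u → v` is a branch of the (unique) reduced representation of `g`. -/
def IsBranch (g : VPerm) (u v : List Bool) : Prop :=
  ∃ T, Represents g T ∧ Reduced T ∧ (u, v) ∈ T

/-- `N(g)`: the number of branches of the reduced representation of `g`. -/
noncomputable def Nbr (g : VPerm) : ℕ :=
  sInf {n | ∃ T, Represents g T ∧ Reduced T ∧ T.card = n}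

/-- `ℓ0(g)`: the unique `ℓ ≥ 1` such that `0^ℓ` is the range code of some
branch of `g`. -/
noncomputable def ell0 (g : VPerm) : ℕ :=
  sInf {ℓ | 1 ≤ ℓ ∧ ∃ u, IsBranch g u (List.replicate ℓ false)}

/-- `ℓ1(g)`: the unique `ℓ ≥ 1` such that `1^ℓ` is the range code of some
branch of `g`. -/
noncomputable def ell1 (g : VPerm) : ℕ :=
  sInf {ℓ | 1 ≤ ℓ ∧ ∃ u, IsBranch g u (List.replicate ℓ true)}

/-- `w` is a strict prefix of the range code of some branch of `g`. -/
def StrictPrefOfBranch (g : VPerm) (w : List Bool) : Prop :=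
  ∃ u v, IsBranch g u v ∧ w <+: v ∧ w ≠ v

/-- Strict lexicographic order on infinite binary words. -/
def lexLt (a b : CSeq) : Prop :=
  ∃ n, (∀ i < n, a i = b i) ∧ a n = false ∧ b n = true

/-- Membership in Thompson's group `F`: an element of `V` preserving the
(lexicographic) order of the Cantor set. -/
def InF (g : VPerm) : Prop :=
  InV g ∧ ∀ a b : CSeq, lexLt a b → lexLt (g a) (g b)

/-- `(a, b, c)` is a (strict) cyclically ordered triple. -/
def cyc3 (a b c : CSeq) : Prop :=
  (lexLt a b ∧ lexLt b c) ∨ (lexLt b c ∧ lexLt c a) ∨ (lexLt c a ∧ lexLt a b)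

/-- Membership in Thompson's group `T`: an element of `V` preserving the
cyclic order of the Cantor set. -/
def InT (g : VPerm) : Prop :=
  InV g ∧ ∀ a b c : CSeq, cyc3 a b c → cyc3 (g a) (g b) (g c)

/-- Word length of `g` with respect to the generating set `S` (letters are
elements of `S` or inverses of elements of `S`). -/
noncomputable def wlen (S : Set VPerm) (g : VPerm) : ℕ :=
  sInf {n | ∃ l : List VPerm,
    l.length = n ∧ (∀ x ∈ l, x ∈ S ∨ x⁻¹ ∈ S) ∧ l.prod = g}

/-- `h'` is the copy `h_{[u]}` of `h` supported on the cylinder of `u`. -/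
def IsCopy (h : VPerm) (u : List Bool) (h' : VPerm) : Prop :=
  (∀ ω : CSeq, h' (app u ω) = app u (h ω)) ∧
  (∀ ω : CSeq, ¬ IsPref u ω → h' ω = ω)

/-- Evaluation (left-to-right) of the word `w` starting at the element `g`:
the paper's product `g · w`. -/
def wordEval (g : VPerm) (w : List VPerm) : VPerm :=
  w.foldl (fun a b => a.trans b) g

/-- Branches of the generator `x0`: `00→0`, `01→10`, `1→11`. -/
def x0T : Finset (List Bool × List Bool) :=
  {([false, false], [false]), ([false, true], [true, false]),
   ([true], [true, true])}

/-- Branches of the generator `x1`: `0→0`, `100→10`, `101→110`, `11→111`. -/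
def x1T : Finset (List Bool × List Bool) :=
  {([false], [false]), ([true, false, false], [true, false]),
   ([true, false, true], [true, true, false]),
   ([true, true], [true, true, true])}

/-- Branches of the generator `c1`: `0→10`, `10→11`, `11→0`. -/
def c1T : Finset (List Bool × List Bool) :=
  {([false], [true, false]), ([true, false], [true, true]),
   ([true, true], [false])}

/-- Branches of the generator `π0`: `0→10`, `10→0`, `11→11`. -/
def pi0T : Finset (List Bool × List Bool) :=
  {([false], [true, false]), ([true, false], [false]),
   ([true, true], [true, true])}

/-- The standard generators `x_j`, `j ≥ 0`, of `F`: for `r ≥ 1`,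
`x_{r+1} = x0^{-r} · x1 · x0^{r}` in the left-to-right convention of the
paper, i.e. `x0 ^ r * x1 * (x0⁻¹) ^ r` in `Equiv.Perm`. -/
def xseq (x0 x1 : VPerm) : ℕ → VPerm
  | 0 => x0
  | r + 1 => x0 ^ r * x1 * (x0⁻¹) ^ r

/-! ### Concatenation of words -/

theorem app_nil (ω : CSeq) : app [] ω = ω := by
  funext n; simp [app]

theorem app_append (u v : List Bool) (ω : CSeq) : app (u ++ v) ω = app u (app v ω) := by
  funext n
  simp only [app, List.length_append]
  by_cases h1 : n < u.length
  · have h2 : n < u.length + v.length := by omega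
    simp [h1, h2, List.getElem_append_left]
  · by_cases h2 : n < u.length + v.length
    · have h3 : n - u.length < v.length := by omega
      simp [h1, h2, h3, List.getElem_append_right (by omega : u.length ≤ n)]
    · have h3 : ¬ n - u.length < v.length := by omega
      simp [h1, h2, h3, Nat.sub_sub]

theorem app_of_lt {u : List Bool} {n : ℕ} (h : n < u.length) (ω : CSeq) : app u ω n = u[n] := by
  simp [app, h]

theorem app_length_add (u : List Bool) (n : ℕ) (ω : CSeq) : app u ω (u.length + n) = ω n := by
  simp [app]

theorem app_cons_zero (b : Bool) (u : List Bool) (ω : CSeq) : app (b :: u) ω 0 = b := by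
  simp [app]

theorem app_cons_succ (b : Bool) (u : List Bool) (ω : CSeq) (n : ℕ) :
    app (b :: u) ω (n + 1) = app u ω n := by
  simp [app]

theorem app_cons_inj {b c : Bool} {u v : List Bool} {ω ω' : CSeq} :
    app (b :: u) ω = app (c :: v) ω' ↔ b = c ∧ app u ω = app v ω' := by
  constructor
  · intro h
    refine ⟨by simpa only [app_cons_zero] using congrFun h 0, funext fun n => ?_⟩
    simpa only [app_cons_succ] using congrFun h (n + 1)
  · rintro ⟨rfl, h⟩
    funext n
    cases n with
    | zero => simp only [app_cons_zero]
    | succ n => simp only [app_cons_succ, h]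

theorem exists_eq_app_singleton (ω : CSeq) : ∃ b ω', ω = app [b] ω' := by
  refine ⟨ω 0, fun n => ω (n + 1), funext fun n => ?_⟩
  cases n <;> simp [app]

/-- The word formed by the first `n` letters of `ω`. -/
def initWord (n : ℕ) (ω : CSeq) : List Bool := List.ofFn fun i : Fin n => ω i

theorem length_initWord (n : ℕ) (ω : CSeq) : (initWord n ω).length = n := by
  simp [initWord]

/-! ### Word length and paths in Cayley graphs -/

theorem wlen_prod_le {S : Set VPerm} {l : List VPerm} (hl : ∀ x ∈ l, x ∈ S ∨ x⁻¹ ∈ S) :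
    wlen S l.prod ≤ l.length :=
  Nat.sInf_le ⟨l, rfl, hl, rfl⟩

theorem exists_word_of_mem_closure {S : Set VPerm} {g : VPerm} (hg : g ∈ Subgroup.closure S) :
    ∃ l : List VPerm, l.length = wlen S g ∧ (∀ x ∈ l, x ∈ S ∨ x⁻¹ ∈ S) ∧ l.prod = g := by
  rw [← Subgroup.mem_toSubmonoid, Subgroup.closure_toSubmonoid] at hg
  obtain ⟨l, hl, hp⟩ := Submonoid.exists_list_of_mem_closure hg
  exact Nat.sInf_mem (s := {n | ∃ l : List VPerm,
    l.length = n ∧ (∀ x ∈ l, x ∈ S ∨ x⁻¹ ∈ S) ∧ l.prod = g}) ⟨l.length, l, rfl, hl, hp⟩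

theorem wlen_letter_le {S : Set VPerm} {x : VPerm} (hx : x ∈ S ∨ x⁻¹ ∈ S) : wlen S x ≤ 1 := by
  have := wlen_prod_le (S := S) (l := [x]) (by simpa using hx)
  simpa using this

theorem mem_closure_of_letter {S : Set VPerm} {x : VPerm} (hx : x ∈ S ∨ x⁻¹ ∈ S) :
    x ∈ Subgroup.closure S := by
  rcases hx with hx | hx
  · exact Subgroup.subset_closure hx
  · exact inv_mem_iff.mp (Subgroup.subset_closure hx)

theorem wlen_mul_le {S : Set VPerm} {g h : VPerm} (hg : g ∈ Subgroup.closure S)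
    (hh : h ∈ Subgroup.closure S) : wlen S (g * h) ≤ wlen S g + wlen S h := by
  obtain ⟨l, h1, h2, rfl⟩ := exists_word_of_mem_closure hg
  obtain ⟨k, k1, k2, rfl⟩ := exists_word_of_mem_closure hh
  rw [← h1, ← k1, ← List.prod_append, ← List.length_append]
  refine wlen_prod_le fun x hx => ?_
  rcases List.mem_append.mp hx with hx | hx
  exacts [h2 x hx, k2 x hx]

theorem wlen_inv_le {S : Set VPerm} {g : VPerm} (hg : g ∈ Subgroup.closure S) :
    wlen S g⁻¹ ≤ wlen S g := by
  obtain ⟨l, h1, h2, rfl⟩ := exists_word_of_mem_closure hg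
  rw [← h1, List.prod_inv_reverse]
  refine (wlen_prod_le fun x hx => ?_).trans (by simp)
  simp only [List.mem_reverse, List.mem_map] at hx
  obtain ⟨y, hy, rfl⟩ := hx
  simpa [or_comm] using h2 y hy

theorem wlen_pow_le {S : Set VPerm} {g : VPerm} (hg : g ∈ Subgroup.closure S) (n : ℕ) :
    wlen S (g ^ n) ≤ n * wlen S g := by
  induction n with
  | zero => simpa using wlen_prod_le (S := S) (l := []) (by simp)
  | succ n ih =>
    rw [pow_succ, add_mul, one_mul]
    exact (wlen_mul_le (pow_mem hg n) hg).trans (by omega)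

theorem le_wlen_mul {S : Set VPerm} {g h : VPerm} (hg : g ∈ Subgroup.closure S)
    (hh : h ∈ Subgroup.closure S) : wlen S h ≤ wlen S (g * h) + wlen S g := by
  have h1 := wlen_mul_le (inv_mem hg) (mul_mem hg hh)
  rw [inv_mul_cancel_left] at h1
  have := wlen_inv_le hg
  omega

theorem eq_one_of_wlen_eq_zero {S : Set VPerm} {g : VPerm} (hg : g ∈ Subgroup.closure S)
    (h : wlen S g = 0) : g = 1 := by
  obtain ⟨l, h1, -, rfl⟩ := exists_word_of_mem_closure hg
  rw [h, List.length_eq_zero_iff] at h1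
  simp [h1]

theorem wordEval_append (g : VPerm) (w w' : List VPerm) :
    wordEval g (w ++ w') = wordEval (wordEval g w) w' := by
  simp [wordEval]

theorem wordEval_eq (g : VPerm) (w : List VPerm) : wordEval g w = w.reverse.prod * g := by
  induction w generalizing g with
  | nil => simp [wordEval]
  | cons x w ih =>
    have : wordEval g (x :: w) = wordEval (x * g) w := rfl
    rw [this, ih]
    simp [mul_assoc]

/-- There is a path from `g` to `h` of length at most `n` in the Cayley graph of `S`, all of whose
vertices satisfy `P`. -/
def Joins (S : Set VPerm) (P : VPerm → Prop) (n : ℕ) (g h : VPerm) : Prop :=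
  ∃ w : List VPerm, (∀ x ∈ w, x ∈ S ∨ x⁻¹ ∈ S) ∧ w.length ≤ n ∧ wordEval g w = h ∧
    ∀ w' : List VPerm, w' <+: w → P (wordEval g w')

theorem Joins.refl {S : Set VPerm} {P : VPerm → Prop} {g : VPerm} (hg : P g) :
    Joins S P 0 g g := by
  refine ⟨[], by simp, by simp, rfl, fun w' hw => ?_⟩
  rw [List.prefix_nil.mp hw]
  exact hg

theorem Joins.trans {S : Set VPerm} {P : VPerm → Prop} {m n : ℕ} {f g h : VPerm}
    (h₁ : Joins S P m f g) (h₂ : Joins S P n g h) : Joins S P (m + n) f h := by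
  obtain ⟨w, a1, a2, a3, a4⟩ := h₁
  obtain ⟨v, b1, b2, b3, b4⟩ := h₂
  refine ⟨w ++ v, fun x hx => ?_, by simp; omega, by rw [wordEval_append, a3, b3], fun w' hw => ?_⟩
  · rcases List.mem_append.mp hx with hx | hx
    exacts [a1 x hx, b1 x hx]
  · rcases List.prefix_or_prefix_of_prefix hw (List.prefix_append w v) with hw' | ⟨t, rfl⟩
    · exact a4 _ hw'
    · rw [wordEval_append, a3]
      exact b4 _ ((List.prefix_append_right_inj w).mp hw)

theorem Joins.mono {S : Set VPerm} {P : VPerm → Prop} {m n : ℕ} {g h : VPerm}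
    (hj : Joins S P m g h) (hmn : m ≤ n) : Joins S P n g h := by
  obtain ⟨w, a1, a2, a3, a4⟩ := hj
  exact ⟨w, a1, a2.trans hmn, a3, a4⟩

theorem Joins.letter {S : Set VPerm} {P : VPerm → Prop} {g x : VPerm} (hx : x ∈ S ∨ x⁻¹ ∈ S)
    (hg : P g) (hxg : P (x * g)) : Joins S P 1 g (x * g) := by
  refine ⟨[x], by simpa using hx, by simp, rfl, fun w' hw => ?_⟩
  rcases w' with _ | ⟨y, w'⟩
  · exact hg
  · obtain ⟨rfl, h⟩ := List.cons_prefix_cons.mp hw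
    rw [List.prefix_nil.mp h]
    exact hxg

theorem Joins.mul {S : Set VPerm} {c : ℕ} {g h : VPerm} (hg : g ∈ Subgroup.closure S)
    (hh : h ∈ Subgroup.closure S) (hc : c + 2 * wlen S h ≤ 2 * wlen S g) :
    Joins S (fun f => c ≤ 2 * wlen S f) (wlen S h) g (h * g) := by
  obtain ⟨l, h1, h2, h3⟩ := exists_word_of_mem_closure hh
  refine ⟨l.reverse, by simpa using h2, by simp [h1], by rw [wordEval_eq]; simp [h3],
    fun w' hw => ?_⟩
  have h4 : ∀ x ∈ w'.reverse, x ∈ S ∨ x⁻¹ ∈ S := fun x hx =>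
    h2 x (List.mem_reverse.mp (hw.subset (List.mem_reverse.mp hx)))
  have h5 : w'.reverse.prod ∈ Subgroup.closure S :=
    list_prod_mem fun x hx => mem_closure_of_letter (h4 x hx)
  have h6 := wlen_prod_le h4
  have h7 := hw.length_le
  have h8 := le_wlen_mul h5 hg
  rw [wordEval_eq]
  simp only [List.length_reverse] at h6 h7
  omega

theorem Joins.letter_pow {S : Set VPerm} {P : VPerm → Prop} {g x : VPerm} (hx : x ∈ S ∨ x⁻¹ ∈ S)
    (n : ℕ) (h : ∀ i ≤ n, P (x ^ i * g)) : Joins S P n g (x ^ n * g) := by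
  induction n with
  | zero => simpa using Joins.refl (by simpa using h 0 le_rfl)
  | succ n ih =>
    have h1 := ih fun i hi => h i (by omega)
    have h2 := h (n + 1) le_rfl
    rw [pow_succ', mul_assoc] at h2 ⊢
    exact h1.trans (Joins.letter hx (h n (by omega)) h2)

theorem Joins.pow {S : Set VPerm} {c : ℕ} {g y : VPerm} (hg : g ∈ Subgroup.closure S)
    (hy : y ∈ Subgroup.closure S) (n : ℕ)
    (h : ∀ i ≤ n, c + 2 * wlen S y ≤ 2 * wlen S (y ^ i * g)) :
    Joins S (fun f => c ≤ 2 * wlen S f) (n * wlen S y) g (y ^ n * g) := by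
  induction n with
  | zero =>
    have := h 0 le_rfl
    simp only [pow_zero, one_mul, zero_mul] at this ⊢
    exact Joins.refl (by omega)
  | succ n ih =>
    have h1 := ih fun i hi => h i (by omega)
    rw [pow_succ', mul_assoc, add_mul, one_mul]
    exact h1.trans (Joins.mul (mul_mem (pow_mem hy n) hg) hy (h n (by omega)))

/-! ### Prefix replacement maps and slopes -/

/-- `h` replaces the prefix `u` by `v`. -/
def CylMap (h : VPerm) (u v : List Bool) : Prop := ∀ ω : CSeq, h (app u ω) = app v ω

theorem CylMap.append {h : VPerm} {u v : List Bool} (hh : CylMap h u v) (t : List Bool) :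
    CylMap h (u ++ t) (v ++ t) := fun ω => by
  rw [app_append, app_append, hh]

theorem CylMap.comp {h k : VPerm} {u v w : List Bool} (hk : CylMap k v w) (hh : CylMap h u v) :
    CylMap (k * h) u w := fun ω => by
  rw [Equiv.Perm.mul_apply, hh, hk]

theorem CylMap.inv {h : VPerm} {u v : List Bool} (hh : CylMap h u v) : CylMap h⁻¹ v u := fun ω => by
  rw [Equiv.Perm.inv_eq_iff_eq, hh]

theorem CylMap.one (u : List Bool) : CylMap 1 u u := fun _ => rfl

theorem CylMap.pow {h : VPerm} {u : List Bool} (hh : CylMap h u u) (n : ℕ) : CylMap (h ^ n) u u := by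
  induction n with
  | zero => exact CylMap.one u
  | succ n ih => exact ih.comp hh

theorem CylMap.pow_shrink {h : VPerm} {u : List Bool} {b : Bool} (hh : CylMap h (u ++ [b]) u)
    (n : ℕ) : CylMap (h ^ n) (u ++ List.replicate n b) u := by
  induction n with
  | zero => simpa using CylMap.one u
  | succ n ih =>
    rw [pow_succ, List.replicate_succ]
    refine ih.comp ?_
    simpa using hh.append (List.replicate n b)

theorem CylMap.pow_expand {h : VPerm} {u : List Bool} {b : Bool} (hh : CylMap h u (u ++ [b]))
    (n : ℕ) : CylMap (h ^ n) u (u ++ List.replicate n b) := by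
  simpa using (hh.inv.pow_shrink n).inv

/-- On the cylinder of the first `a` letters of `z`, the map `h` replaces these letters by the first
`b` letters of `h z`. -/
def AffAt (h : VPerm) (z : CSeq) (a b : ℕ) : Prop :=
  ∀ z' : CSeq, (∀ i < a, z' i = z i) → (∀ i < b, h z' i = h z i) ∧ ∀ i, h z' (b + i) = z' (a + i)

theorem eq_app_of_agree {u : List Bool} {ω z : CSeq} (h : ∀ i < u.length, z i = app u ω i) :
    z = app u fun i => z (u.length + i) := by
  funext i
  by_cases hi : i < u.length
  · rw [h i hi, app_of_lt hi, app_of_lt hi]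
  · obtain ⟨j, rfl⟩ := Nat.exists_eq_add_of_le (not_lt.mp hi)
    rw [app_length_add]

theorem CylMap.affAt {h : VPerm} {u v : List Bool} (hh : CylMap h u v) (ω : CSeq) :
    AffAt h (app u ω) u.length v.length := by
  intro z' hz
  rw [eq_app_of_agree hz, hh, hh]
  refine ⟨fun i hi => ?_, fun i => ?_⟩
  · rw [app_of_lt hi, app_of_lt hi]
  · rw [app_length_add, app_length_add]

theorem AffAt.cylMap {h : VPerm} {z : CSeq} {a b : ℕ} (hh : AffAt h z a b) :
    CylMap h (initWord a z) (initWord b (h z)) := by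
  intro ω
  have h1 : ∀ i < a, app (initWord a z) ω i = z i := fun i hi => by
    rw [app_of_lt (by rwa [length_initWord])]
    simp [initWord]
  obtain ⟨h2, h3⟩ := hh _ h1
  funext i
  by_cases hi : i < b
  · rw [h2 i hi, app_of_lt (by rwa [length_initWord])]
    simp [initWord]
  · obtain ⟨j, rfl⟩ := Nat.exists_eq_add_of_le (not_lt.mp hi)
    rw [h3]
    have := app_length_add (initWord a z) j ω
    have := app_length_add (initWord b (h z)) j ω
    simp_all [length_initWord]

theorem AffAt.extend {h : VPerm} {z : CSeq} {a b : ℕ} (hh : AffAt h z a b) (t : ℕ) :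
    AffAt h z (a + t) (b + t) := by
  intro z' hz
  obtain ⟨h1, h2⟩ := hh z' fun i hi => hz i (by omega)
  have h3 := (hh z fun _ _ => rfl).2
  refine ⟨fun i hi => ?_, fun i => ?_⟩
  · by_cases hib : i < b
    · exact h1 i hib
    · obtain ⟨j, rfl⟩ := Nat.exists_eq_add_of_le (not_lt.mp hib)
      rw [h2, h3, hz _ (by omega)]
  · rw [add_assoc, h2, add_assoc]

theorem AffAt.comp {h k : VPerm} {z : CSeq} {a b c : ℕ} (hk : AffAt k (h z) b c)
    (hh : AffAt h z a b) : AffAt (k * h) z a c := by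
  intro z' hz
  obtain ⟨h1, h2⟩ := hh z' hz
  obtain ⟨h3, h4⟩ := hk (h z') h1
  exact ⟨h3, fun i => (h4 i).trans (h2 i)⟩

theorem AffAt.unique {h : VPerm} {z : CSeq} {a b a' b' : ℕ} (hh : AffAt h z a b)
    (hh' : AffAt h z a' b') : a + b' = a' + b := by
  have key : ∀ {c d e : ℕ}, AffAt h z c d → AffAt h z c e → ¬ d < e := by
    intro c d e h1 h2 hde
    have h3 : ∀ i < c, Function.update z c (!z c) i = z i := fun i hi =>
      Function.update_of_ne hi.ne _ _
    have h4 := (h1 _ h3).2 0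
    have h5 := (h1 z fun _ _ => rfl).2 0
    have h6 := (h2 _ h3).1 d hde
    simp only [add_zero, Function.update_self] at h4 h5
    rw [h4, h5] at h6
    simp at h6
  have h1 := hh.extend a'
  have h2 := hh'.extend a
  rw [add_comm a' a] at h2
  have h3 := key h1 h2
  have h4 := key h2 h1
  omega

/-- Every letter over `S` acts near every point by replacing a prefix of length at most `3` by a
prefix whose length differs by at most `1`. -/
def Tame (S : Set VPerm) : Prop :=
  ∀ x : VPerm, (x ∈ S ∨ x⁻¹ ∈ S) → ∀ z : CSeq,
    ∃ a b : ℕ, a ≤ 3 ∧ a ≤ b + 1 ∧ b ≤ a + 1 ∧ AffAt x z a b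

theorem Tame.affAt_prod {S : Set VPerm} (hS : Tame S) (z : CSeq) (l : List VPerm)
    (hl : ∀ x ∈ l, x ∈ S ∨ x⁻¹ ∈ S) :
    ∃ a b : ℕ, a ≤ 3 * l.length ∧ b ≤ 4 * l.length ∧ a ≤ b + l.length ∧ b ≤ a + l.length ∧
      AffAt l.prod z a b := by
  induction l with
  | nil => exact ⟨0, 0, by simp, by simp, by simp, by simp, fun z' _ => by simp⟩
  | cons x l ih =>
    obtain ⟨a, b, h1, h2, h3, h4, h5⟩ := ih fun y hy => hl y (List.mem_cons_of_mem x hy)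
    obtain ⟨c, d, k1, k2, k3, k4⟩ := hS x (hl x List.mem_cons_self) (l.prod z)
    have e1 := h5.extend (c - b)
    have e2 := k4.extend (b - c)
    rw [show c + (b - c) = b + (c - b) by omega] at e2
    rw [List.prod_cons, List.length_cons]
    exact ⟨_, _, by omega, by omega, by omega, by omega, e2.comp e1⟩

theorem Tame.affAt {S : Set VPerm} (hS : Tame S) {g : VPerm} (hg : g ∈ Subgroup.closure S)
    (z : CSeq) : ∃ a b : ℕ, a ≤ 3 * wlen S g ∧ b ≤ 4 * wlen S g ∧ AffAt g z a b := by
  obtain ⟨l, h1, h2, rfl⟩ := exists_word_of_mem_closure hg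
  obtain ⟨a, b, h3, h4, -, -, h5⟩ := hS.affAt_prod z l h2
  rw [h1] at h3 h4
  exact ⟨a, b, h3, h4, h5⟩

theorem Tame.slope_le {S : Set VPerm} (hS : Tame S) {g : VPerm} (hg : g ∈ Subgroup.closure S)
    {z : CSeq} {a b : ℕ} (h : AffAt g z a b) : a ≤ b + wlen S g ∧ b ≤ a + wlen S g := by
  obtain ⟨l, h1, h2, rfl⟩ := exists_word_of_mem_closure hg
  obtain ⟨c, d, -, -, h3, h4, h5⟩ := hS.affAt_prod z l h2
  have := h.unique h5
  omega

theorem Tame.slope_le_of_cylMap {S : Set VPerm} (hS : Tame S) {g : VPerm}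
    (hg : g ∈ Subgroup.closure S) {u v : List Bool} (h : CylMap g u v) :
    u.length ≤ v.length + wlen S g ∧ v.length ≤ u.length + wlen S g :=
  hS.slope_le hg (h.affAt fun _ => false)

theorem Represents.cylMap {g : VPerm} {T : Finset (List Bool × List Bool)} (h : Represents g T)
    {u v : List Bool} (huv : (u, v) ∈ T) : CylMap g u v :=
  h.2.2 _ huv

theorem Represents.exists_affAt {g : VPerm} {T : Finset (List Bool × List Bool)}
    (h : Represents g T)
    (hT : ∀ p ∈ T, p.1.length ≤ 3 ∧ p.1.length ≤ p.2.length + 1 ∧ p.2.length ≤ p.1.length + 1)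
    (z : CSeq) : ∃ a b : ℕ, a ≤ 3 ∧ a ≤ b + 1 ∧ b ≤ a + 1 ∧ AffAt g z a b := by
  obtain ⟨p, ⟨hp, ω, rfl⟩, -⟩ := h.1 z
  obtain ⟨h1, h2, h3⟩ := hT p hp
  exact ⟨_, _, h1, h2, h3, CylMap.affAt (h.2.2 p hp) ω⟩

theorem Represents.exists_affAt_inv {g : VPerm} {T : Finset (List Bool × List Bool)}
    (h : Represents g T)
    (hT : ∀ p ∈ T, p.2.length ≤ 3 ∧ p.2.length ≤ p.1.length + 1 ∧ p.1.length ≤ p.2.length + 1)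
    (z : CSeq) : ∃ a b : ℕ, a ≤ 3 ∧ a ≤ b + 1 ∧ b ≤ a + 1 ∧ AffAt g⁻¹ z a b := by
  obtain ⟨p, ⟨hp, ω, rfl⟩, -⟩ := h.2.1 z
  obtain ⟨h1, h2, h3⟩ := hT p hp
  exact ⟨_, _, h1, h2, h3, CylMap.affAt (CylMap.inv (h.2.2 p hp)) ω⟩

theorem tame_gens {x0 x1 c1 : VPerm} (hx0 : Represents x0 x0T) (hx1 : Represents x1 x1T)
    (hc1 : Represents c1 c1T) : Tame {x0, x1, c1} := by
  intro x hx z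
  simp only [Set.mem_insert_iff, Set.mem_singleton_iff, inv_eq_iff_eq_inv] at hx
  rcases hx with (rfl | rfl | rfl) | (rfl | rfl | rfl)
  · exact hx0.exists_affAt (by decide) z
  · exact hx1.exists_affAt (by decide) z
  · exact hc1.exists_affAt (by decide) z
  · exact hx0.exists_affAt_inv (by decide) z
  · exact hx1.exists_affAt_inv (by decide) z
  · exact hc1.exists_affAt_inv (by decide) z

/-! ### Orders on the Cantor set -/

theorem lexLt_app_cons {b c : Bool} {u v : List Bool} {ω ω' : CSeq} :
    lexLt (app (b :: u) ω) (app (c :: v) ω') ↔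
      (b = false ∧ c = true) ∨ (b = c ∧ lexLt (app u ω) (app v ω')) := by
  constructor
  · rintro ⟨n, h1, h2, h3⟩
    cases n with
    | zero => exact Or.inl ⟨by simpa only [app_cons_zero] using h2,
        by simpa only [app_cons_zero] using h3⟩
    | succ n =>
      refine Or.inr ⟨by simpa only [app_cons_zero] using h1 0 (by omega), n, fun i hi => ?_, ?_, ?_⟩
      · simpa only [app_cons_succ] using h1 (i + 1) (by omega)
      · simpa only [app_cons_succ] using h2
      · simpa only [app_cons_succ] using h3
  · rintro (⟨rfl, rfl⟩ | ⟨rfl, n, h1, h2, h3⟩)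
    · exact ⟨0, by simp, by simp only [app_cons_zero], by simp only [app_cons_zero]⟩
    · refine ⟨n + 1, fun i hi => ?_, ?_, ?_⟩
      · cases i with
        | zero => simp only [app_cons_zero]
        | succ i => simpa only [app_cons_succ] using h1 i (by omega)
      · simpa only [app_cons_succ] using h2
      · simpa only [app_cons_succ] using h3

/-- The group of permutations of the Cantor set preserving and reflecting the cyclic order. -/
def cycAut : Subgroup VPerm where
  carrier := {h | ∀ a b c, cyc3 (h a) (h b) (h c) ↔ cyc3 a b c}
  mul_mem' := fun {f g} hf hg a b c => (hf _ _ _).trans (hg a b c)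
  one_mem' := fun _ _ _ => Iff.rfl
  inv_mem' := fun {f} hf a b c => by
    simpa using (hf (f⁻¹ a) (f⁻¹ b) (f⁻¹ c)).symm

theorem mem_cycAut_of_lexLt {h : VPerm} (hh : ∀ a b, lexLt (h a) (h b) ↔ lexLt a b) :
    h ∈ cycAut := fun a b c => by
  simp only [cyc3, hh]

theorem closure_le_cycAut {x0 x1 c1 : VPerm} (hx0 : Represents x0 x0T) (hx1 : Represents x1 x1T)
    (hc1 : Represents c1 c1T) : Subgroup.closure {x0, x1, c1} ≤ cycAut := by
  rw [Subgroup.closure_le]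
  rintro x (rfl | rfl | rfl)
  · refine mem_cycAut_of_lexLt fun a b => ?_
    obtain ⟨p, ⟨hp, a, rfl⟩, -⟩ := hx0.1 a
    obtain ⟨q, ⟨hq, b, rfl⟩, -⟩ := hx0.1 b
    rw [hx0.2.2 p hp, hx0.2.2 q hq]
    simp only [x0T, Finset.mem_insert, Finset.mem_singleton] at hp hq
    rcases hp with rfl | rfl | rfl <;> rcases hq with rfl | rfl | rfl <;>
      simp [lexLt_app_cons, app_nil]
  · refine mem_cycAut_of_lexLt fun a b => ?_
    obtain ⟨p, ⟨hp, a, rfl⟩, -⟩ := hx1.1 a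
    obtain ⟨q, ⟨hq, b, rfl⟩, -⟩ := hx1.1 b
    rw [hx1.2.2 p hp, hx1.2.2 q hq]
    simp only [x1T, Finset.mem_insert, Finset.mem_singleton] at hp hq
    rcases hp with rfl | rfl | rfl | rfl <;> rcases hq with rfl | rfl | rfl | rfl <;>
      simp [lexLt_app_cons, app_nil]
  · intro a b c
    obtain ⟨p, ⟨hp, a, rfl⟩, -⟩ := hc1.1 a
    obtain ⟨q, ⟨hq, b, rfl⟩, -⟩ := hc1.1 b
    obtain ⟨r, ⟨hr, c, rfl⟩, -⟩ := hc1.1 c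
    rw [hc1.2.2 p hp, hc1.2.2 q hq, hc1.2.2 r hr]
    simp only [c1T, Finset.mem_insert, Finset.mem_singleton] at hp hq hr
    rcases hp with rfl | rfl | rfl <;> rcases hq with rfl | rfl | rfl <;>
      rcases hr with rfl | rfl | rfl <;> simp [cyc3, lexLt_app_cons, app_nil]

/-! ### Complete prefix codes -/

theorem IsPref.of_append {u t : List Bool} {ω : CSeq} (h : IsPref (u ++ t) ω) : IsPref u ω := by
  obtain ⟨ω', rfl⟩ := h
  exact ⟨_, app_append u t ω'⟩

theorem IsPref.exists_append {u : List Bool} {ω : CSeq} (h : IsPref u ω) :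
    ∃ b, IsPref (u ++ [b]) ω := by
  obtain ⟨ω', rfl⟩ := h
  obtain ⟨b, ω'', rfl⟩ := exists_eq_app_singleton ω'
  exact ⟨b, ω'', (app_append u [b] ω'').symm⟩

theorem IsPref.prefix {u v : List Bool} {ω : CSeq} (hu : IsPref u ω) (hv : IsPref v ω)
    (huv : u.length ≤ v.length) : u <+: v := by
  induction u generalizing v ω with
  | nil => exact List.nil_prefix
  | cons b u ih =>
    cases v with
    | nil => simp at huv
    | cons c v =>
      obtain ⟨ω₁, rfl⟩ := hu
      obtain ⟨ω₂, h⟩ := hv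
      obtain ⟨rfl, h'⟩ := app_cons_inj.mp h
      exact List.cons_prefix_cons.mpr ⟨rfl, ih ⟨ω₁, rfl⟩ ⟨ω₂, h'⟩ (by simpa using huv)⟩

/-- Every infinite word has exactly one prefix in `C`. -/
def CompleteCode (C : Finset (List Bool)) : Prop := ∀ ω : CSeq, ∃! v, v ∈ C ∧ IsPref v ω

theorem CompleteCode.eq_of_prefix {C : Finset (List Bool)} (hC : CompleteCode C) {u v : List Bool}
    (hu : u ∈ C) (hv : v ∈ C) (huv : u <+: v) : u = v := by
  obtain ⟨t, rfl⟩ := huv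
  have h : IsPref (u ++ t) (app (u ++ t) fun _ => false) := ⟨_, rfl⟩
  exact (hC _).unique ⟨hu, h.of_append⟩ ⟨hv, h⟩

theorem CompleteCode.exists_siblings {C : Finset (List Bool)} (hC : CompleteCode C)
    (h : ∃ v ∈ C, v ≠ []) : ∃ w, ∀ b, w ++ [b] ∈ C := by
  obtain ⟨v₀, hv₀, hne⟩ := h
  obtain ⟨v, hv, hmax⟩ := C.exists_max_image List.length ⟨v₀, hv₀⟩
  have hvne : v ≠ [] := by
    rintro rfl
    exact hne (List.length_eq_zero_iff.mp (Nat.le_zero.mp (hmax v₀ hv₀)))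
  obtain ⟨w, b, rfl⟩ : ∃ w b, v = w ++ [b] :=
    ⟨_, _, (List.dropLast_append_getLast hvne).symm⟩
  refine ⟨w, fun b' => ?_⟩
  obtain ⟨v', ⟨hv', hp⟩, -⟩ := hC (app (w ++ [b']) fun _ => false)
  have hlen := hmax v' hv'
  have hpre : v' <+: w ++ [b'] := hp.prefix ⟨_, rfl⟩ (by simpa using hlen)
  rcases List.prefix_concat_iff.mp hpre with rfl | hpre
  · exact hv'
  · have := hC.eq_of_prefix hv' hv (hpre.trans (List.prefix_append w [b]))
    have h1 := hpre.length_le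
    simp [this] at h1

theorem CompleteCode.merge {C : Finset (List Bool)} (hC : CompleteCode C) {w : List Bool}
    (hw : ∀ b, w ++ [b] ∈ C) :
    CompleteCode (insert w ((C.erase (w ++ [false])).erase (w ++ [true]))) := by
  intro ω
  by_cases hp : IsPref w ω
  · obtain ⟨b, hb⟩ := hp.exists_append
    refine ⟨w, ⟨Finset.mem_insert_self _ _, hp⟩, ?_⟩
    rintro v ⟨hv, hvp⟩
    simp only [Finset.mem_insert, Finset.mem_erase] at hv
    rcases hv with rfl | ⟨h1, h2, h3⟩
    · rfl
    · have := (hC ω).unique ⟨h3, hvp⟩ ⟨hw b, hb⟩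
      cases b
      exacts [absurd this h2, absurd this h1]
  · obtain ⟨v, ⟨hv, hvp⟩, huniq⟩ := hC ω
    refine ⟨v, ⟨?_, hvp⟩, ?_⟩
    · simp only [Finset.mem_insert, Finset.mem_erase]
      refine Or.inr ⟨?_, ?_, hv⟩ <;> rintro rfl <;> exact hp hvp.of_append
    · rintro v' ⟨hv', hvp'⟩
      simp only [Finset.mem_insert, Finset.mem_erase] at hv'
      rcases hv' with rfl | ⟨-, -, h3⟩
      · exact absurd hvp' hp
      · exact huniq v' ⟨h3, hvp'⟩

theorem CompleteCode.card_merge {C : Finset (List Bool)} (hC : CompleteCode C) {w : List Bool}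
    (hw : ∀ b, w ++ [b] ∈ C) :
    (insert w ((C.erase (w ++ [false])).erase (w ++ [true]))).card + 1 = C.card := by
  have hwC : w ∉ C := fun h => by
    simpa using hC.eq_of_prefix h (hw false) (List.prefix_append w [false])
  have h1 : w ++ [true] ∈ C.erase (w ++ [false]) := by simp [hw]
  rw [Finset.card_insert_of_notMem (by simp [hwC]), Finset.card_erase_of_mem h1,
    Finset.card_erase_of_mem (hw false)]
  have := Finset.card_pos.mpr ⟨_, h1⟩
  rw [Finset.card_erase_of_mem (hw false)] at this
  omega

/-! ### Generation of `T` -/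

/-- The `i`-th leaf of the right vine `0, 10, 110, …, 1ᴺ⁻¹` with `N` leaves. -/
def vineLeaf (N i : ℕ) : List Bool :=
  List.replicate i true ++ if i + 1 < N then [false] else []

theorem vineLeaf_of_lt {N i : ℕ} (h : i + 1 < N) :
    vineLeaf N i = List.replicate i true ++ [false] := by
  simp [vineLeaf, h]

theorem vineLeaf_last (N : ℕ) : vineLeaf (N + 1) N = List.replicate N true := by
  simp [vineLeaf]

theorem cylMap_xseq_succ {x0 x1 : VPerm} (hx0 : Represents x0 x0T) {r : ℕ} {u v : List Bool}
    (h : CylMap (xseq x0 x1 (r + 1)) (true :: u) (true :: v)) :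
    CylMap (xseq x0 x1 (r + 2)) (true :: true :: u) (true :: true :: v) := by
  have h0 : CylMap x0 [true] [true, true] := hx0.cylMap (by decide)
  have e : xseq x0 x1 (r + 2) = x0 * xseq x0 x1 (r + 1) * x0⁻¹ := by
    simp only [xseq]
    rw [pow_succ', pow_succ]
    simp only [mul_assoc]
  rw [e]
  exact ((h0.append v).comp h).comp (h0.append u).inv

theorem cylMap_xseq_replicate {x0 x1 : VPerm} (hx0 : Represents x0 x0T) {u v : List Bool}
    (h₀ : CylMap x0 u v) (h₁ : CylMap x1 (true :: u) (true :: v)) (r : ℕ) :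
    CylMap (xseq x0 x1 r) (List.replicate r true ++ u) (List.replicate r true ++ v) := by
  induction r with
  | zero => simpa [xseq] using h₀
  | succ r ih =>
    cases r with
    | zero => simpa [xseq] using h₁
    | succ r =>
      simp only [List.replicate_succ, List.cons_append] at ih ⊢
      exact cylMap_xseq_succ hx0 ih

theorem cylMap_xseq_fixed {x0 x1 : VPerm} (hx0 : Represents x0 x0T) (hx1 : Represents x1 x1T)
    {i j : ℕ} (hij : j < i) :
    CylMap (xseq x0 x1 i) (List.replicate j true ++ [false]) (List.replicate j true ++ [false]) := by
  obtain ⟨r, rfl⟩ : ∃ r, i = r + 1 := ⟨i - 1, by omega⟩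
  induction r generalizing j with
  | zero =>
    obtain rfl : j = 0 := by omega
    simpa [xseq] using hx1.cylMap (by decide : ([false], [false]) ∈ x1T)
  | succ r ih =>
    have e : xseq x0 x1 (r + 2) = x0 * xseq x0 x1 (r + 1) * x0⁻¹ := by
      simp only [xseq]
      rw [pow_succ', pow_succ]
      simp only [mul_assoc]
    have hf : CylMap (xseq x0 x1 (r + 1)) [false] [false] := ih (j := 0) (by omega)
    rcases j with _ | _ | j
    · have h0 : CylMap x0 [false, false] [false] := hx0.cylMap (by decide)
      rw [e]
      exact (h0.comp (hf.append [false])).comp h0.inv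
    · have h0 : CylMap x0 [false, true] [true, false] := hx0.cylMap (by decide)
      rw [e]
      exact (h0.comp (hf.append [true])).comp h0.inv
    · have := ih (j := j + 1) (by omega)
      simp only [List.replicate_succ, List.cons_append] at this ⊢
      exact cylMap_xseq_succ hx0 this

theorem xseq_mem {x0 x1 : VPerm} {G : Subgroup VPerm} (h0 : x0 ∈ G) (h1 : x1 ∈ G) (r : ℕ) :
    xseq x0 x1 r ∈ G := by
  cases r with
  | zero => exact h0
  | succ r => exact mul_mem (mul_mem (pow_mem h0 r) h1) (pow_mem (inv_mem h0) r)

theorem xseq_zero_zero {x0 x1 : VPerm} (hx0 : Represents x0 x0T) (hx1 : Represents x1 x1T) (r : ℕ) :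
    CylMap (xseq x0 x1 r) (List.replicate r true ++ [false, false])
      (List.replicate r true ++ [false]) :=
  cylMap_xseq_replicate hx0 (hx0.cylMap (by decide)) (hx1.cylMap (by decide)) r

theorem xseq_zero_one {x0 x1 : VPerm} (hx0 : Represents x0 x0T) (hx1 : Represents x1 x1T) (r : ℕ) :
    CylMap (xseq x0 x1 r) (List.replicate r true ++ [false, true])
      (List.replicate r true ++ [true, false]) :=
  cylMap_xseq_replicate hx0 (hx0.cylMap (by decide)) (hx1.cylMap (by decide)) r

theorem xseq_one {x0 x1 : VPerm} (hx0 : Represents x0 x0T) (hx1 : Represents x1 x1T) (r : ℕ) :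
    CylMap (xseq x0 x1 r) (List.replicate r true ++ [true])
      (List.replicate r true ++ [true, true]) :=
  cylMap_xseq_replicate hx0 (hx0.cylMap (by decide)) (hx1.cylMap (by decide)) r

theorem exists_mem_vine {x0 x1 : VPerm} (hx0 : Represents x0 x0T) (hx1 : Represents x1 x1T)
    {G : Subgroup VPerm} (h0 : x0 ∈ G) (h1 : x1 ∈ G) (n : ℕ) {C : Finset (List Bool)}
    (hC : CompleteCode C) (hn : C.card = n + 1) :
    ∃ h ∈ G, ∀ u ∈ C, ∃ i < n + 1, CylMap h u (vineLeaf (n + 1) i) := by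
  induction n generalizing C with
  | zero =>
    refine ⟨1, one_mem G, fun u hu => ⟨0, by omega, ?_⟩⟩
    obtain rfl : u = [] := by
      by_contra hne
      obtain ⟨w, hw⟩ := hC.exists_siblings ⟨u, hu, hne⟩
      have := Finset.card_le_one.mp hn.le _ (hw false) _ (hw true)
      simp at this
    exact CylMap.one []
  | succ n ih =>
    obtain ⟨w, hw⟩ : ∃ w, ∀ b, w ++ [b] ∈ C := by
      obtain ⟨a, ha, b, hb, hab⟩ := Finset.one_lt_card.mp (by omega : 1 < C.card)
      refine hC.exists_siblings ?_
      by_cases h : a = []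
      · exact ⟨b, hb, fun hb' => hab (h.trans hb'.symm)⟩
      · exact ⟨a, ha, h⟩
    obtain ⟨h, hh, hmap⟩ := ih (hC.merge hw) (by have := hC.card_merge hw; omega)
    obtain ⟨i, hi, hwi⟩ := hmap w (Finset.mem_insert_self _ _)
    have hother : ∀ u ∈ C, u ≠ w ++ [false] → u ≠ w ++ [true] →
        ∃ j < n + 1, j ≠ i ∧ CylMap h u (vineLeaf (n + 1) j) := by
      intro u hu hu0 hu1
      obtain ⟨j, hj, hmj⟩ := hmap u (by simp [hu, hu0, hu1])
      refine ⟨j, hj, ?_, hmj⟩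
      rintro rfl
      have e : app u (fun _ => false) = app w fun _ => false :=
        h.injective ((hmj _).trans (hwi _).symm)
      have e' : app w (fun _ => false) = app (w ++ [false]) fun _ => false := by
        rw [app_append]
        congr 1
        funext k
        cases k <;> simp [app]
      exact hu0 ((hC (app u fun _ => false)).unique ⟨hu, _, rfl⟩ ⟨hw false, _, e.trans e'⟩)
    have hcases : ∀ u ∈ C, u = w ++ [false] ∨ u = w ++ [true] ∨
        (u ≠ w ++ [false] ∧ u ≠ w ++ [true]) := fun u _ => by tauto
    by_cases hin : i = n
    · subst hin
      rw [vineLeaf_last] at hwi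
      refine ⟨h, hh, fun u hu => ?_⟩
      rcases hcases u hu with rfl | rfl | ⟨hu0, hu1⟩
      · refine ⟨i, by omega, ?_⟩
        rw [vineLeaf_of_lt (by omega)]
        exact hwi.append [false]
      · refine ⟨i + 1, by omega, ?_⟩
        rw [vineLeaf_last, List.replicate_succ']
        exact hwi.append [true]
      · obtain ⟨j, hj, hji, hmj⟩ := hother u hu hu0 hu1
        refine ⟨j, by omega, ?_⟩
        rw [vineLeaf_of_lt (by omega)] at hmj ⊢
        exact hmj
    · rw [vineLeaf_of_lt (by omega)] at hwi
      refine ⟨xseq x0 x1 i * h, mul_mem (xseq_mem h0 h1 i) hh, fun u hu => ?_⟩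
      rcases hcases u hu with rfl | rfl | ⟨hu0, hu1⟩
      · refine ⟨i, by omega, ?_⟩
        rw [vineLeaf_of_lt (by omega)]
        refine (xseq_zero_zero hx0 hx1 i).comp ?_
        simpa using hwi.append [false]
      · refine ⟨i + 1, by omega, ?_⟩
        rw [vineLeaf_of_lt (by omega), List.replicate_succ']
        have := (xseq_zero_one hx0 hx1 i).comp (h := h) (u := w ++ [true])
          (by simpa using hwi.append [true])
        simpa using this
      · obtain ⟨j, hj, hji, hmj⟩ := hother u hu hu0 hu1
        rcases lt_or_gt_of_ne hji with hji | hji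
        · refine ⟨j, by omega, ?_⟩
          rw [vineLeaf_of_lt (by omega)] at hmj ⊢
          exact (cylMap_xseq_fixed hx0 hx1 hji).comp hmj
        · refine ⟨j + 1, by omega, ?_⟩
          obtain ⟨k, rfl⟩ := Nat.exists_eq_add_of_lt hji
          have h2 := ((xseq_one hx0 hx1 i).append
            (List.replicate k true ++ if i + k + 1 + 1 < n + 1 then [false] else [])).comp
            (h := h) (u := u) (by
              convert hmj using 1
              simp only [vineLeaf, add_assoc, List.replicate_add, List.append_assoc, add_comm k 1]
              rfl)
          convert h2 using 1
          simp only [vineLeaf, add_assoc, List.replicate_add, List.append_assoc, add_comm k 1]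
          simp only [← add_assoc]
          have hiff : i + 1 + 1 + 1 + k < n + 1 + 1 ↔ i + 1 + 1 + k < n + 1 := by omega
          simp only [hiff]
          rfl

theorem exists_rotation {x0 x1 c1 : VPerm} (hx0 : Represents x0 x0T) (hx1 : Represents x1 x1T)
    (hc1 : Represents c1 c1T) {G : Subgroup VPerm} (h0 : x0 ∈ G) (h1 : x1 ∈ G) (hc : c1 ∈ G)
    (n : ℕ) :
    ∃ h ∈ G, (∀ i < n + 1, CylMap h (vineLeaf (n + 2) i) (vineLeaf (n + 2) (i + 1))) ∧
      CylMap h (vineLeaf (n + 2) (n + 1)) (vineLeaf (n + 2) 0) := by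
  induction n with
  | zero =>
    refine ⟨c1 * x0, mul_mem hc h0, fun i hi => ?_, ?_⟩
    · obtain rfl : i = 0 := by omega
      intro ω
      obtain ⟨b, ω, rfl⟩ := exists_eq_app_singleton ω
      rw [← app_append, ← app_append]
      cases b
      · exact (hc1.cylMap (by decide : ([false], [true, false]) ∈ c1T)).comp
          (hx0.cylMap (by decide : ([false, false], [false]) ∈ x0T)) ω
      · exact (hc1.cylMap (by decide : ([true, false], [true, true]) ∈ c1T)).comp
          (hx0.cylMap (by decide : ([false, true], [true, false]) ∈ x0T)) ω
    · exact (hc1.cylMap (by decide : ([true, true], [false]) ∈ c1T)).comp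
        (hx0.cylMap (by decide : ([true], [true, true]) ∈ x0T))
  | succ n ih =>
    obtain ⟨h, hh, hstep, hlast⟩ := ih
    have e0 := hstep n (by omega)
    rw [vineLeaf_of_lt (by omega), vineLeaf_last] at e0
    rw [vineLeaf_last] at hlast
    refine ⟨h * (xseq x0 x1 n)⁻¹, mul_mem hh (inv_mem (xseq_mem h0 h1 n)), fun i hi => ?_, ?_⟩
    · rcases (by omega : i < n ∨ i = n ∨ i = n + 1) with hin | rfl | rfl
      · have := hstep i (by omega)
        rw [vineLeaf_of_lt (by omega), vineLeaf_of_lt (by omega)] at this ⊢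
        exact this.comp (cylMap_xseq_fixed hx0 hx1 hin).inv
      · rw [vineLeaf_of_lt (by omega), vineLeaf_of_lt (by omega)]
        refine CylMap.comp (v := List.replicate i true ++ [false, false]) ?_
          (xseq_zero_zero hx0 hx1 i).inv
        simpa using e0.append [false]
      · rw [vineLeaf_of_lt (by omega), vineLeaf_last]
        refine CylMap.comp (v := List.replicate n true ++ [false, true]) ?_ ?_
        · have := e0.append [true]
          rw [← List.replicate_succ'] at this
          simpa using this
        · have := (xseq_zero_one hx0 hx1 n).inv
          rw [List.replicate_succ']
          simpa using this
    · rw [vineLeaf_last, vineLeaf_of_lt (by omega)]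
      rw [vineLeaf_of_lt (by omega), List.replicate_succ'] at hlast
      refine hlast.comp ?_
      have := (xseq_one hx0 hx1 n).inv
      rw [List.replicate_succ', List.replicate_succ']
      simpa using this

theorem lexLt_vineLeaf {N i j : ℕ} (hij : i < j) (hj : j < N) (ω ω' : CSeq) :
    lexLt (app (vineLeaf N i) ω) (app (vineLeaf N j) ω') := by
  obtain ⟨k, rfl⟩ := Nat.exists_eq_add_of_lt hij
  rw [vineLeaf_of_lt (by omega), vineLeaf, add_assoc, List.replicate_add, List.append_assoc]
  induction i generalizing N with
  | zero => simp [List.replicate_succ, lexLt_app_cons]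
  | succ i ih =>
    rw [List.replicate_succ, List.cons_append, List.cons_append, lexLt_app_cons]
    refine Or.inr ⟨rfl, ?_⟩
    have := ih (N := N - 1) (by omega) (by omega)
    convert this using 4
    congr 1
    simp only [eq_iff_iff]
    omega

theorem not_lexLt_self (ω : CSeq) : ¬ lexLt ω ω := by
  rintro ⟨n, -, h1, h2⟩
  rw [h1] at h2
  exact absurd h2 (by decide)

theorem lexLt_asymm {a b : CSeq} (hab : lexLt a b) (hba : lexLt b a) : False := by
  obtain ⟨n, h1, h2, h3⟩ := hab
  obtain ⟨m, k1, k2, k3⟩ := hba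
  rcases lt_trichotomy n m with h | rfl | h
  · have := k1 n h
    simp_all
  · simp_all
  · have := h1 m h
    simp_all

theorem vineLeaf_inj {N i j : ℕ} (hi : i < N) (hj : j < N) {ω ω' : CSeq}
    (h : app (vineLeaf N i) ω = app (vineLeaf N j) ω') : i = j := by
  rcases lt_trichotomy i j with hij | hij | hij
  · exact absurd (h ▸ lexLt_vineLeaf hij hj ω ω') (not_lexLt_self _)
  · exact hij
  · exact absurd (h ▸ lexLt_vineLeaf hij hi ω' ω) (not_lexLt_self _)

theorem lexLt_vineLeaf_iff {N i j : ℕ} (hi : i < N) (hj : j < N) (hne : i ≠ j) (ω ω' : CSeq) :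
    lexLt (app (vineLeaf N i) ω) (app (vineLeaf N j) ω') ↔ i < j := by
  refine ⟨fun h => ?_, fun h => lexLt_vineLeaf h hj ω ω'⟩
  by_contra hlt
  exact lexLt_asymm h (lexLt_vineLeaf (by omega) hi ω' ω)

theorem exists_isPref_vineLeaf (n : ℕ) (z : CSeq) :
    ∃ i < n + 1, IsPref (vineLeaf (n + 1) i) z := by
  induction n with
  | zero => exact ⟨0, by omega, z, by simp [vineLeaf, app_nil]⟩
  | succ n ih =>
    obtain ⟨i, hi, h⟩ := ih
    rcases (by omega : i < n ∨ i = n) with hin | rfl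
    · refine ⟨i, by omega, ?_⟩
      rwa [vineLeaf_of_lt (by omega)] at h ⊢
    · rw [vineLeaf_last] at h
      obtain ⟨b, hb⟩ := h.exists_append
      cases b
      · exact ⟨i, by omega, by rwa [vineLeaf_of_lt (by omega)]⟩
      · exact ⟨i + 1, by omega, by rwa [vineLeaf_last, List.replicate_succ']⟩

/-- `f` permutes the leaves of the right vine with `N` leaves. -/
def PermutesVine (f : VPerm) (N : ℕ) : Prop :=
  ∀ i < N, ∃ j < N, CylMap f (vineLeaf N i) (vineLeaf N j)

theorem PermutesVine.mul {f g : VPerm} {N : ℕ} (hf : PermutesVine f N) (hg : PermutesVine g N) :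
    PermutesVine (f * g) N := by
  intro i hi
  obtain ⟨j, hj, h1⟩ := hg i hi
  obtain ⟨k, hk, h2⟩ := hf j hj
  exact ⟨k, hk, h2.comp h1⟩

theorem PermutesVine.pow {f : VPerm} {N : ℕ} (hf : PermutesVine f N) (n : ℕ) :
    PermutesVine (f ^ n) N := by
  induction n with
  | zero => exact fun i hi => ⟨i, hi, CylMap.one _⟩
  | succ n ih => exact ih.mul hf

theorem PermutesVine.eq_one {f : VPerm} {n : ℕ} (hf : PermutesVine f (n + 1))
    (h0 : CylMap f (vineLeaf (n + 1) 0) (vineLeaf (n + 1) 0))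
    (hcyc : ∀ a b c, cyc3 a b c → cyc3 (f a) (f b) (f c)) : f = 1 := by
  choose! σ hσ hmap using hf
  have hz : σ 0 = 0 := by
    refine vineLeaf_inj (hσ 0 (by omega)) (by omega) (ω := fun _ => false) (ω' := fun _ => false) ?_
    rw [← hmap 0 (by omega), h0]
  have hinj : ∀ i < n + 1, ∀ j < n + 1, σ i = σ j → i = j := by
    intro i hi j hj hij
    refine vineLeaf_inj hi hj (f.injective (a₁ := app _ fun _ => false)
      (a₂ := app _ fun _ => false) ?_)
    rw [hmap i hi, hmap j hj, hij]
  have hmono : ∀ i j, i < j → j < n + 1 → σ i < σ j := by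
    intro i j hij hj
    have hj0 : σ j ≠ 0 := fun h => by
      have := hinj j hj 0 (by omega) (h.trans hz.symm)
      omega
    rcases Nat.eq_zero_or_pos i with rfl | hi
    · omega
    · have hi0 : σ i ≠ 0 := fun h => by
        have := hinj i (by omega) 0 (by omega) (h.trans hz.symm)
        omega
      have hne : σ i ≠ σ j := fun h => by
        have := hinj i (by omega) j hj h
        omega
      have h1 := hcyc (app (vineLeaf (n + 1) 0) fun _ => false)
        (app (vineLeaf (n + 1) i) fun _ => false) (app (vineLeaf (n + 1) j) fun _ => false)
        (Or.inl ⟨lexLt_vineLeaf hi (by omega) _ _, lexLt_vineLeaf hij hj _ _⟩)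
      rw [h0, hmap i (by omega), hmap j hj] at h1
      have b1 := hσ i (by omega)
      have b2 := hσ j hj
      simp only [cyc3, lexLt_vineLeaf_iff b1 b2 hne, lexLt_vineLeaf_iff b2 (by omega : 0 < n + 1) hj0,
        lexLt_vineLeaf_iff (by omega : 0 < n + 1) b1 hi0.symm] at h1
      omega
  have hge : ∀ i, i < n + 1 → i ≤ σ i := by
    intro i
    induction i with
    | zero => exact fun _ => Nat.zero_le _
    | succ i ih =>
      intro hi
      have := ih (by omega)
      have := hmono i (i + 1) (by omega) hi
      omega
  have hle : ∀ k i, i + k = n → σ i ≤ i := by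
    intro k
    induction k with
    | zero =>
      intro i hi
      have := hσ i (by omega)
      omega
    | succ k ih =>
      intro i hi
      have := ih (i + 1) (by omega)
      have := hmono i (i + 1) (by omega) (by omega)
      omega
  ext1 z
  obtain ⟨i, hi, ω, rfl⟩ := exists_isPref_vineLeaf n z
  have h1 := hge i hi
  have h2 := hle (n - i) i (by omega)
  rw [hmap i hi, le_antisymm h2 h1]
  rfl

theorem completeCode_image {T : Finset (List Bool × List Bool)}
    {π : List Bool × List Bool → List Bool}
    (h : ∀ ω : CSeq, ∃! p : List Bool × List Bool, p ∈ T ∧ IsPref (π p) ω) :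
    CompleteCode (T.image π) ∧ (T.image π).card = T.card := by
  constructor
  · intro ω
    obtain ⟨p, ⟨hp, hpω⟩, huniq⟩ := h ω
    refine ⟨π p, ⟨Finset.mem_image_of_mem π hp, hpω⟩, ?_⟩
    rintro v ⟨hv, hvω⟩
    obtain ⟨q, hq, rfl⟩ := Finset.mem_image.mp hv
    rw [huniq q ⟨hq, hvω⟩]
  · refine Finset.card_image_of_injOn fun p hp q hq hpq => ?_
    exact (h (app (π p) fun _ => false)).unique ⟨hp, _, rfl⟩ ⟨hq, _, by rw [← hpq]⟩

theorem mem_closure_of_inT {x0 x1 c1 : VPerm} (hx0 : Represents x0 x0T) (hx1 : Represents x1 x1T)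
    (hc1 : Represents c1 c1T) {g : VPerm} (hg : InT g) : g ∈ Subgroup.closure {x0, x1, c1} := by
  obtain ⟨⟨T, hT⟩, hcyc⟩ := hg
  have hcl := closure_le_cycAut hx0 hx1 hc1
  set G := Subgroup.closure {x0, x1, c1}
  have h0 : x0 ∈ G := Subgroup.subset_closure (by simp)
  have h1 : x1 ∈ G := Subgroup.subset_closure (by simp)
  have hc : c1 ∈ G := Subgroup.subset_closure (by simp)
  obtain ⟨hU, hUc⟩ := completeCode_image hT.1
  obtain ⟨hV, hVc⟩ := completeCode_image hT.2.1
  obtain ⟨n, hn⟩ : ∃ n, T.card = n + 1 := by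
    obtain ⟨p, ⟨hp, -⟩, -⟩ := hT.1 fun _ => false
    have := Finset.card_pos.mpr ⟨p, hp⟩
    exact ⟨T.card - 1, by omega⟩
  obtain ⟨α, hα, hαm⟩ := exists_mem_vine hx0 hx1 h0 h1 n hU (hUc.trans hn)
  obtain ⟨β, hβ, hβm⟩ := exists_mem_vine hx0 hx1 h0 h1 n hV (hVc.trans hn)
  have hf : PermutesVine (β * g * α⁻¹) (n + 1) := by
    intro i hi
    obtain ⟨p, ⟨hp, ω, hω⟩, -⟩ := hT.1 (α⁻¹ (app (vineLeaf (n + 1) i) fun _ => false))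
    obtain ⟨k, hk, hak⟩ := hαm p.1 (Finset.mem_image_of_mem _ hp)
    obtain ⟨j, hj, hbj⟩ := hβm p.2 (Finset.mem_image_of_mem _ hp)
    rw [Equiv.Perm.inv_eq_iff_eq, hak] at hω
    obtain rfl := vineLeaf_inj hi hk hω
    exact ⟨j, hj, (hbj.comp (hT.2.2 p hp)).comp hak.inv⟩
  have hfcyc : ∀ a b c, cyc3 a b c →
      cyc3 ((β * g * α⁻¹) a) ((β * g * α⁻¹) b) ((β * g * α⁻¹) c) := fun a b c h =>
    (hcl hβ _ _ _).mpr (hcyc _ _ _ ((hcl (inv_mem hα) _ _ _).mpr h))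
  suffices h : ∃ r ∈ G, PermutesVine r (n + 1) ∧
      CylMap (r * (β * g * α⁻¹)) (vineLeaf (n + 1) 0) (vineLeaf (n + 1) 0) by
    obtain ⟨r, hr, hrp, hr0⟩ := h
    have h2 := (hrp.mul hf).eq_one hr0 fun a b c h => (hcl hr _ _ _).mpr (hfcyc a b c h)
    have h3 : g = β⁻¹ * r⁻¹ * α := by
      rw [← mul_assoc, ← mul_assoc, mul_inv_eq_one] at h2
      rw [← h2]
      group
    rw [h3]
    exact mul_mem (mul_mem (inv_mem hβ) (inv_mem hr)) hα
  obtain ⟨j, hj, hfj⟩ := hf 0 (by omega)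
  rcases Nat.eq_zero_or_pos j with rfl | hjpos
  · exact ⟨1, one_mem G, fun i hi => ⟨i, hi, CylMap.one _⟩, by rwa [one_mul]⟩
  obtain ⟨m, rfl⟩ : ∃ m, n = m + 1 := ⟨n - 1, by omega⟩
  obtain ⟨ρ, hρ, hstep, hlast⟩ := exists_rotation hx0 hx1 hc1 h0 h1 hc m
  have hρp : PermutesVine ρ (m + 1 + 1) := by
    intro i hi
    rcases (by omega : i < m + 1 ∨ i = m + 1) with h | rfl
    · exact ⟨i + 1, by omega, hstep i h⟩
    · exact ⟨0, by omega, hlast⟩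
  have hpow : ∀ k, j + k ≤ m + 1 →
      CylMap (ρ ^ k) (vineLeaf (m + 2) j) (vineLeaf (m + 2) (j + k)) := by
    intro k
    induction k with
    | zero => exact fun _ => CylMap.one _
    | succ k ih =>
      intro hk
      rw [pow_succ']
      exact (hstep (j + k) (by omega)).comp (ih (by omega))
  refine ⟨ρ * ρ ^ (m + 1 - j), mul_mem hρ (pow_mem hρ _), hρp.mul (hρp.pow _), ?_⟩
  have h2 := hpow (m + 1 - j) (by omega)
  rw [Nat.add_sub_cancel' (by omega)] at h2
  exact (hlast.comp h2).comp hfj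

theorem perm_inv_apply_self (f : VPerm) (z : CSeq) : f⁻¹ (f z) = z :=
  f.symm_apply_apply z

theorem perm_apply_inv_self (f : VPerm) (z : CSeq) : f (f⁻¹ z) = z :=
  f.apply_symm_apply z

/-! ### Conjugates of a one-sided translation -/

/-- `y` fixes the cylinder of `1` pointwise, preserves the cylinder of `0`, contracts the word `000`
to `00` and expands the word `01` to `011`. -/
structure IsSlide (y : VPerm) : Prop where
  shrink : CylMap y [false, false, false] [false, false]
  expand : CylMap y [false, true] [false, true, true]
  fix : CylMap y [true] [true]

theorem isSlide {x0 x1 : VPerm} (hx0 : Represents x0 x0T) (hx1 : Represents x1 x1T) :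
    IsSlide (x0⁻¹ * x1⁻¹ * (x0 * x0)) := by
  have a1 := hx0.cylMap (by decide : ([false, false], [false]) ∈ x0T)
  have a2 := hx0.cylMap (by decide : ([false, true], [true, false]) ∈ x0T)
  have a3 := hx0.cylMap (by decide : ([true], [true, true]) ∈ x0T)
  have b1 := hx1.cylMap (by decide : ([false], [false]) ∈ x1T)
  have b2 := hx1.cylMap (by decide : ([true, false, true], [true, true, false]) ∈ x1T)
  have b3 := hx1.cylMap (by decide : ([true, true], [true, true, true]) ∈ x1T)
  exact
    { shrink := (a1.inv.comp b1.inv).comp (a1.comp (a1.append [false]))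
      expand := ((a2.inv.append [true]).comp b2.inv).comp ((a3.append [false]).comp a2)
      fix := (a3.inv.comp b3.inv).comp ((a3.append [true]).comp a3) }

theorem IsSlide.le_wlen {S : Set VPerm} (hS : Tame S) {y A B : VPerm} (hy : IsSlide y)
    (hyS : y ∈ Subgroup.closure S) (hA : A ∈ Subgroup.closure S) (hB : B ∈ Subgroup.closure S)
    {u w : List Bool} (hAu : CylMap A u [false]) (hBw : CylMap B [false] w) (m : ℕ) :
    m ≤ wlen S (B * y ^ m * A) := by
  have hmem := mul_mem (mul_mem hB (pow_mem hyS m)) hA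
  have h1 : CylMap (y ^ m) ([false, false] ++ List.replicate m false) [false, false] :=
    CylMap.pow_shrink hy.shrink m
  have h2 : CylMap (y ^ m) [false, true] ([false, true] ++ List.replicate m true) :=
    CylMap.pow_expand hy.expand m
  have h3 := hS.slope_le_of_cylMap hmem
    (((hBw.append [false]).comp h1).comp (hAu.append ([false] ++ List.replicate m false)))
  have h4 := hS.slope_le_of_cylMap hmem
    (((hBw.append ([true] ++ List.replicate m true)).comp h2).comp (hAu.append [true]))
  simp only [List.length_append, List.length_replicate, List.length_cons, List.length_nil] at h3 h4
  omega

theorem IsSlide.pow_app_false {y : VPerm} (hy : IsSlide y) (m : ℕ) (ω : CSeq) :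
    ∃ ω', (y ^ m) (app [false] ω) = app [false] ω' := by
  obtain ⟨b, ω', h⟩ := exists_eq_app_singleton ((y ^ m) (app [false] ω))
  cases b
  · exact ⟨ω', h⟩
  · rw [← (hy.fix.pow m) ω', (y ^ m).injective.eq_iff, app_cons_inj] at h
    exact absurd h.1 (by decide)

theorem IsSlide.commute {y A X : VPerm} (hy : IsSlide y) {u : List Bool}
    (hA : CylMap A u [false]) (hX : CylMap X u u) (m : ℕ) :
    X * (A⁻¹ * y ^ m * A) = (A⁻¹ * y ^ m * A) * X := by
  have hfix : ∀ z, ¬ IsPref u z → (A⁻¹ * y ^ m * A) z = z := by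
    intro z hz
    obtain ⟨b, ω, h⟩ := exists_eq_app_singleton (A z)
    cases b
    · refine absurd ⟨ω, ?_⟩ hz
      rw [← hA.inv ω, ← h, perm_inv_apply_self]
    · rw [Equiv.Perm.mul_apply, Equiv.Perm.mul_apply, h, hy.fix.pow m, ← h,
        perm_inv_apply_self]
  ext1 z
  rw [Equiv.Perm.mul_apply, Equiv.Perm.mul_apply _ X]
  by_cases hz : IsPref u z
  · obtain ⟨ω, rfl⟩ := hz
    obtain ⟨ω', h⟩ := hy.pow_app_false m ω
    rw [hX ω, Equiv.Perm.mul_apply, Equiv.Perm.mul_apply, hA, h, hA.inv, hX]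
  · rw [hfix z hz, hfix]
    rintro ⟨ω, h⟩
    rw [← hX ω, X.injective.eq_iff] at h
    exact hz ⟨ω, h⟩

/-- A path from `R` to `X * R` extends to `X` when `X` commutes with `R` and is much longer. -/
theorem Joins.of_commute {S : Set VPerm} {c n : ℕ} {R X : VPerm}
    (h : Joins S (fun f => c ≤ 2 * wlen S f) n R (X * R)) (hR : R ∈ Subgroup.closure S)
    (hX : X ∈ Subgroup.closure S) (hcomm : X * R = R * X)
    (hlong : c + 4 * wlen S R ≤ 2 * wlen S X) :
    Joins S (fun f => c ≤ 2 * wlen S f) (n + wlen S R) R X := by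
  have h1 := wlen_inv_le hR
  have h2 := le_wlen_mul hR hX
  have h3 := Joins.mul (c := c) (mul_mem hR hX) (inv_mem hR) (by omega)
  rw [inv_mul_cancel_left, ← hcomm] at h3
  exact (h.trans h3).mono (by omega)

/-! ### Pushing an arbitrary element to a standard one -/

theorem initWord_const (n : ℕ) (b : Bool) :
    initWord n (fun _ => b) = List.replicate n b := by
  simp [initWord]

theorem Tame.exists_cylMap_replicate {S : Set VPerm} (hS : Tame S) {g : VPerm}
    (hg : g ∈ Subgroup.closure S) (b : Bool) {n : ℕ} (hn : 4 * wlen S g < n) :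
    ∃ u, u ≠ [] ∧ CylMap g u (List.replicate n b) := by
  obtain ⟨c, d, -, h2, h3⟩ := hS.affAt hg (g⁻¹ fun _ => b)
  have h4 := (h3.extend (n - d)).cylMap
  rw [perm_apply_inv_self, initWord_const, Nat.add_sub_cancel' (by omega)] at h4
  refine ⟨_, fun h => ?_, h4⟩
  have := congrArg List.length h
  rw [length_initWord, List.length_nil] at this
  omega

theorem le_two_mul_wlen_pow_mul {S : Set VPerm} {g x : VPerm} (hx : x ∈ S ∨ x⁻¹ ∈ S)
    (hg : g ∈ Subgroup.closure S) {i : ℕ} (h : i ≤ wlen S (x ^ i * g)) :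
    wlen S g ≤ 2 * wlen S (x ^ i * g) := by
  have hxS := mem_closure_of_letter hx
  have h1 := le_wlen_mul (pow_mem hxS i) hg
  have h2 := wlen_pow_le hxS i
  have h3 := Nat.mul_le_mul_left i (wlen_letter_le hx)
  omega

/-- A power of `x0` or of its inverse pushes `g` away from the identity to an element mapping some
proper cylinder onto the cylinder of `0`. -/
theorem exists_joins_cylMap {S : Set VPerm} (hS : Tame S) {x0 c1 g : VPerm}
    (hx0 : Represents x0 x0T) (hc1 : Represents c1 c1T) (h0 : x0 ∈ S) (hc : c1 ∈ S)
    (hg : g ∈ Subgroup.closure S) (hL : 1 ≤ wlen S g) :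
    ∃ A ∈ Subgroup.closure S, ∃ u, u ≠ [] ∧ CylMap A u [false] ∧
      99 * wlen S g ≤ wlen S A ∧ wlen S A ≤ 102 * wlen S g ∧
      Joins S (fun f => wlen S g ≤ 2 * wlen S f) (101 * wlen S g) g A := by
  set L := wlen S g with hLdef
  have a1 := hx0.cylMap (by decide : ([false, false], [false]) ∈ x0T)
  have a3 := hx0.cylMap (by decide : ([true], [true, true]) ∈ x0T)
  have hx0S : x0 ∈ Subgroup.closure S := Subgroup.subset_closure h0
  have hx0l : x0 ∈ S ∨ x0⁻¹ ∈ S := Or.inl h0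
  have hx0l' : x0⁻¹ ∈ S ∨ x0⁻¹⁻¹ ∈ S := Or.inr (by rwa [inv_inv])
  have upper : ∀ x, (x ∈ S ∨ x⁻¹ ∈ S) → wlen S (x ^ (100 * L) * g) ≤ 101 * L := by
    intro x hx
    have hxS := mem_closure_of_letter hx
    have h1 := wlen_mul_le (pow_mem hxS (100 * L)) hg
    have h2 := wlen_pow_le hxS (100 * L)
    have h3 := Nat.mul_le_mul_left (100 * L) (wlen_letter_le hx)
    omega
  obtain ⟨a, b, -, -, hab⟩ := hS.affAt hg (g⁻¹ fun _ => false)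
  have hext : ∀ t, CylMap g (initWord (a + t) (g⁻¹ fun _ => false))
      (List.replicate (t + b) false) := by
    intro t
    have := (hab.extend t).cylMap
    rwa [perm_apply_inv_self, initWord_const, add_comm b t] at this
  rcases le_or_gt b a with hba | hba
  · have far : ∀ i, i ≤ wlen S (x0 ^ i * g) := by
      intro i
      have h1 := hext (1 + i)
      rw [List.replicate_add, List.replicate_add] at h1
      have h2 : CylMap (x0 ^ i) ([false] ++ List.replicate i false) [false] :=
        CylMap.pow_shrink a1 i
      have h3 := hS.slope_le_of_cylMap (mul_mem (pow_mem hx0S i) hg)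
        ((h2.append (List.replicate b false)).comp h1)
      simp only [List.length_append, List.length_replicate, List.length_cons, List.length_nil,
        length_initWord] at h3
      omega
    obtain ⟨u, hu, hgu⟩ := hS.exists_cylMap_replicate hg false (n := 1 + 100 * L) (by omega)
    rw [List.replicate_add] at hgu
    refine ⟨x0 ^ (100 * L) * g, mul_mem (pow_mem hx0S _) hg, u, hu,
      (CylMap.pow_shrink (u := [false]) a1 (100 * L)).comp hgu, ?_, ?_, ?_⟩
    · have := far (100 * L)
      omega
    · have := upper x0 hx0l
      omega
    · exact (Joins.letter_pow hx0l (100 * L)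
        fun i _ => le_two_mul_wlen_pow_mul hx0l hg (far i)).mono (by omega)
  · have far : ∀ i, i ≤ wlen S (x0⁻¹ ^ i * g) := by
      intro i
      have h1 := hext 1
      rw [List.replicate_add] at h1
      have h2 : CylMap (x0⁻¹ ^ i) [false] ([false] ++ List.replicate i false) :=
        CylMap.pow_expand a1.inv i
      have h3 := hS.slope_le_of_cylMap (mul_mem (pow_mem (inv_mem hx0S) i) hg)
        ((h2.append (List.replicate b false)).comp h1)
      simp only [List.length_append, List.length_replicate, List.length_cons, List.length_nil,
        length_initWord] at h3
      omega
    obtain ⟨u, hu, hgu⟩ := hS.exists_cylMap_replicate hg true (n := 1 + 100 * L + 1) (by omega)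
    rw [List.replicate_add, List.replicate_add] at hgu
    have hcS : c1 ∈ Subgroup.closure S := Subgroup.subset_closure hc
    have hmem := mul_mem (pow_mem (inv_mem hx0S) (100 * L)) hg
    have hfar := far (100 * L)
    have hletter := wlen_letter_le (S := S) (x := c1) (Or.inl hc)
    have hlower := wlen_mul_le (inv_mem hcS) (mul_mem hcS hmem)
    rw [inv_mul_cancel_left] at hlower
    have hinv := wlen_inv_le hcS
    have hle := wlen_mul_le hcS hmem
    have hupper := upper _ hx0l'
    refine ⟨c1 * (x0⁻¹ ^ (100 * L) * g), mul_mem hcS hmem, u, hu, ?_, by omega, by omega, ?_⟩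
    · exact (hc1.cylMap (by decide : ([true, true], [false]) ∈ c1T)).comp
        (((CylMap.pow_shrink (u := [true]) a3.inv (100 * L)).append [true]).comp hgu)
    · exact ((Joins.letter_pow hx0l' (100 * L)
        fun i _ => le_two_mul_wlen_pow_mul hx0l' hg (far i)).trans
          (Joins.letter (Or.inl hc) (by omega) (by omega))).mono (by omega)

theorem IsSlide.wlen_conj_le {S : Set VPerm} {y A : VPerm} (hyS : y ∈ Subgroup.closure S)
    (hy4 : wlen S y ≤ 4) (hA : A ∈ Subgroup.closure S) (m : ℕ) :
    wlen S (A⁻¹ * y ^ m * A) ≤ 4 * m + 2 * wlen S A := by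
  have h1 := wlen_mul_le (mul_mem (inv_mem hA) (pow_mem hyS m)) hA
  have h2 := wlen_mul_le (inv_mem hA) (pow_mem hyS m)
  have h3 := wlen_inv_le hA
  have h4 := wlen_pow_le hyS m
  have h5 := Nat.mul_le_mul_left m hy4
  omega

/-- From `A` one can reach the conjugate of a large power of `y` by `A`. -/
theorem IsSlide.joins_conj {S : Set VPerm} (hS : Tame S) {y A : VPerm} (hy : IsSlide y)
    (hyS : y ∈ Subgroup.closure S) (hy4 : wlen S y ≤ 4) (hA : A ∈ Subgroup.closure S)
    {u : List Bool} (hAu : CylMap A u [false]) {L : ℕ} (hL : 1 ≤ L)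
    (h1 : 99 * L ≤ wlen S A) (h2 : wlen S A ≤ 102 * L) :
    Joins S (fun f => L ≤ 2 * wlen S f) (4200 * L) A (A⁻¹ * y ^ (1000 * L) * A) := by
  have far : ∀ i, i ≤ wlen S (y ^ i * A) := fun i => by
    simpa using hy.le_wlen hS hyS hA (one_mem _) hAu (CylMap.one _) i
  have hp : Joins S (fun f => L ≤ 2 * wlen S f) (1000 * L * wlen S y) A
      (y ^ (1000 * L) * A) := by
    refine Joins.pow hA hyS _ fun i _ => ?_
    have k1 := far i
    have k2 := le_wlen_mul (pow_mem hyS i) hA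
    have k3 := wlen_pow_le hyS i
    have k4 := Nat.mul_le_mul_left i hy4
    omega
  have k1 := far (1000 * L)
  have k2 := wlen_inv_le hA
  have k3 := Nat.mul_le_mul_left (1000 * L) hy4
  have hq := Joins.mul (c := L) (mul_mem (pow_mem hyS (1000 * L)) hA) (inv_mem hA) (by omega)
  rw [← mul_assoc] at hq
  exact (hp.trans hq).mono (by omega)

/-- A conjugate of a power of `y` supported in the cylinder of `0` can be joined to one supported in
the cylinder of `1`. -/
theorem IsSlide.joins_conj_inv {S : Set VPerm} (hS : Tame S) {y A c1 : VPerm} (hy : IsSlide y)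
    (hyS : y ∈ Subgroup.closure S) (hy4 : wlen S y ≤ 4) (hA : A ∈ Subgroup.closure S)
    (hc1 : Represents c1 c1T) (hc : c1 ∈ S) {s : List Bool}
    (hAu : CylMap A (false :: s) [false]) {L : ℕ} (hL : 1 ≤ L) (hAL : wlen S A ≤ 102 * L) :
    Joins S (fun f => L ≤ 2 * wlen S f) (500000 * L) (A⁻¹ * y ^ (1000 * L) * A)
      (c1⁻¹⁻¹ * y ^ (100000 * L) * c1⁻¹) := by
  have hcS : c1⁻¹ ∈ Subgroup.closure S := inv_mem (Subgroup.subset_closure hc)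
  have hcl : c1⁻¹ ∈ S ∨ c1⁻¹⁻¹ ∈ S := Or.inr (by rwa [inv_inv])
  have hcl' : c1⁻¹⁻¹ ∈ S ∨ c1⁻¹⁻¹⁻¹ ∈ S := Or.inl (by rwa [inv_inv])
  have hc0 : CylMap c1⁻¹ [false] [true, true] :=
    (hc1.cylMap (by decide : ([true, true], [false]) ∈ c1T)).inv
  have hc10 : CylMap c1⁻¹ [true, false] [false] :=
    (hc1.cylMap (by decide : ([false], [true, false]) ∈ c1T)).inv
  have hR := mul_mem (mul_mem (inv_mem hA) (pow_mem hyS (1000 * L))) hA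
  have hcu : CylMap (c1⁻¹ * A⁻¹) [false] (true :: true :: s) := (hc0.append s).comp hAu.inv
  have hyu : ∀ i, CylMap (y ^ i) (true :: true :: s) (true :: true :: s) := fun i =>
    (hy.fix.append (true :: s)).pow i
  have hX : CylMap (c1⁻¹⁻¹ * y ^ (100000 * L) * c1⁻¹) (false :: s) (false :: s) :=
    (((hc0.append s).inv).comp (hyu _)).comp (hc0.append s)
  have hXS := mul_mem (mul_mem (inv_mem hcS) (pow_mem hyS (100000 * L))) hcS
  have far : ∀ B ∈ Subgroup.closure S, ∀ w, CylMap (B * A⁻¹) [false] w →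
      1000 * L ≤ wlen S (B * (A⁻¹ * y ^ (1000 * L) * A)) := by
    intro B hB w hw
    have := hy.le_wlen hS hyS hA (mul_mem hB (inv_mem hA)) hAu hw (1000 * L)
    simpa only [mul_assoc] using this
  have far_pow : ∀ i, 1000 * L ≤
      wlen S (y ^ i * (c1⁻¹ * (A⁻¹ * y ^ (1000 * L) * A))) := by
    intro i
    rw [← mul_assoc]
    refine far _ (mul_mem (pow_mem hyS i) hcS) (true :: true :: s) ?_
    rw [mul_assoc]
    exact (hyu i).comp hcu
  have p1 : Joins S (fun f => L ≤ 2 * wlen S f) 1 (A⁻¹ * y ^ (1000 * L) * A)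
      (c1⁻¹ * (A⁻¹ * y ^ (1000 * L) * A)) := by
    refine Joins.letter hcl ?_ ?_
    · have := far 1 (one_mem _) _ (by simpa using hAu.inv)
      rw [one_mul] at this
      omega
    · have := far _ hcS _ hcu
      omega
  have p2 := Joins.pow (c := L) (mul_mem hcS hR) hyS (100000 * L) fun i _ => by
    have := far_pow i
    omega
  have p3 : Joins S (fun f => L ≤ 2 * wlen S f) 1
      (y ^ (100000 * L) * (c1⁻¹ * (A⁻¹ * y ^ (1000 * L) * A)))
      (c1⁻¹⁻¹ * y ^ (100000 * L) * c1⁻¹ * (A⁻¹ * y ^ (1000 * L) * A)) := by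
    have h1 := far_pow (100000 * L)
    have h2 := far _ hXS _ (hX.comp hAu.inv)
    have h3 : c1⁻¹⁻¹ * y ^ (100000 * L) * c1⁻¹ * (A⁻¹ * y ^ (1000 * L) * A) =
        c1⁻¹⁻¹ * (y ^ (100000 * L) * (c1⁻¹ * (A⁻¹ * y ^ (1000 * L) * A))) := by
      simp only [mul_assoc]
    rw [h3] at h2 ⊢
    exact Joins.letter hcl' (by omega) (by omega)
  have hlen := IsSlide.wlen_conj_le hyS hy4 hA (1000 * L)
  have hlong := hy.le_wlen hS hyS hcS (inv_mem hcS) hc10 hc10.inv (100000 * L)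
  have k := Nat.mul_le_mul_left (100000 * L) hy4
  exact (Joins.of_commute ((p1.trans p2).trans p3) hR hXS (hy.commute hAu hX _)
    (by omega)).mono (by omega)

theorem AffAt.of_agree {h : VPerm} {z z' : CSeq} {a b : ℕ} (hh : AffAt h z a b)
    (hz : ∀ i < a, z' i = z i) : AffAt h z' a b := by
  intro z'' hz''
  obtain ⟨h1, -⟩ := hh z' hz
  obtain ⟨h2, h3⟩ := hh z'' fun i hi => (hz'' i hi).trans (hz i hi)
  exact ⟨fun i hi => (h2 i hi).trans (h1 i hi).symm, h3⟩

theorem le_three_mul_wlen {S : Set VPerm} (hS : Tame S) {x0 x1 : VPerm}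
    (hx0 : Represents x0 x0T) (hx1 : Represents x1 x1T) (p : ℕ)
    (hX : x0⁻¹ ^ (p + 1) * (x1⁻¹ * x0 ^ (p + 2)) ∈ Subgroup.closure S) :
    p + 2 ≤ 3 * wlen S (x0⁻¹ ^ (p + 1) * (x1⁻¹ * x0 ^ (p + 2))) := by
  have a1 := hx0.cylMap (by decide : ([false, false], [false]) ∈ x0T)
  have a2 := hx0.cylMap (by decide : ([false, true], [true, false]) ∈ x0T)
  have b1 := hx1.cylMap (by decide : ([false], [false]) ∈ x1T)
  have b2 := hx1.cylMap (by decide : ([true, false, false], [true, false]) ∈ x1T)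
  have h1 : CylMap (x0⁻¹ ^ (p + 1) * (x1⁻¹ * x0 ^ (p + 2)))
      ([false] ++ List.replicate (p + 2) false) ([false] ++ List.replicate (p + 1) false) :=
    (CylMap.pow_expand (u := [false]) a1.inv (p + 1)).comp
      (b1.inv.comp (CylMap.pow_shrink (u := [false]) a1 (p + 2)))
  have h2 : CylMap (x0⁻¹ ^ (p + 1) * (x1⁻¹ * x0 ^ (p + 2)))
      (([false] ++ List.replicate (p + 1) false) ++ [true])
      (([false] ++ List.replicate p false) ++ [true, false]) := by
    rw [pow_succ x0⁻¹ p, pow_succ' x0 (p + 1)]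
    exact (((CylMap.pow_expand (u := [false]) a1.inv p).append [true, false]).comp
      (a2.inv.append [false])).comp (b2.inv.comp
        (a2.comp ((CylMap.pow_shrink (u := [false]) a1 (p + 1)).append [true])))
  by_contra hlt
  obtain ⟨a, b, ha, -, hab⟩ := hS.affAt hX
    (app ([false] ++ List.replicate (p + 2) false) fun _ => false)
  have e1 := hab.unique (h1.affAt _)
  have e2 := (hab.of_agree (z' := app (([false] ++ List.replicate (p + 1) false) ++ [true])
    fun _ => false) fun i hi => by
      rw [app_of_lt (by simp; omega), app_of_lt (by simp; omega),
        List.getElem_append_left (by simp; omega)]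
      cases i <;> simp).unique (h2.affAt _)
  simp only [List.length_append, List.length_replicate, List.length_cons, List.length_nil] at e1 e2
  omega

/-- A conjugate of a power of `y` supported in the cylinder of `1` can be joined to a standard
element. -/
theorem IsSlide.joins_standard {S : Set VPerm} (hS : Tame S) {y A x0 x1 : VPerm} (hy : IsSlide y)
    (hyS : y ∈ Subgroup.closure S) (hA : A ∈ Subgroup.closure S)
    (hx0 : Represents x0 x0T) (hx1 : Represents x1 x1T) (h0 : x0 ∈ S) (h1 : x1 ∈ S) {s : List Bool}
    (hAu : CylMap A (true :: s) [false]) {m L p : ℕ} (hm : L ≤ m)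
    (hlong : 6 * wlen S (A⁻¹ * y ^ m * A) + 2 * L ≤ p) :
    Joins S (fun f => L ≤ 2 * wlen S f) (3 * p + 4) (A⁻¹ * y ^ m * A)
      (x0⁻¹ ^ (p + 1) * (x1⁻¹ * x0 ^ (p + 2))) := by
  have a3 := hx0.cylMap (by decide : ([true], [true, true]) ∈ x0T)
  have b3 := hx1.cylMap (by decide : ([true, true], [true, true, true]) ∈ x1T)
  have h0S : x0 ∈ Subgroup.closure S := Subgroup.subset_closure h0
  have h1S : x1 ∈ Subgroup.closure S := Subgroup.subset_closure h1
  have hR := mul_mem (mul_mem (inv_mem hA) (pow_mem hyS m)) hA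
  have far : ∀ B ∈ Subgroup.closure S, ∀ w, CylMap B [true] w →
      L ≤ 2 * wlen S (B * (A⁻¹ * y ^ m * A)) := by
    intro B hB w hw
    have := hy.le_wlen hS hyS hA (mul_mem hB (inv_mem hA)) hAu ((hw.append s).comp hAu.inv) m
    rw [show B * (A⁻¹ * y ^ m * A) = B * A⁻¹ * y ^ m * A by simp only [mul_assoc]]
    omega
  have e0 : ∀ i, CylMap (x0 ^ i) [true] ([true] ++ List.replicate i true) := fun i =>
    CylMap.pow_expand a3 i
  have e1 : CylMap (x1⁻¹ * x0 ^ (p + 2)) [true] ([true] ++ List.replicate (p + 1) true) :=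
    (b3.inv.append (List.replicate p true)).comp (e0 (p + 2))
  have e2 : ∀ j ≤ p + 1, CylMap (x0⁻¹ ^ j * (x1⁻¹ * x0 ^ (p + 2))) [true]
      ([true] ++ List.replicate (p + 1 - j) true) := by
    intro j hj
    refine CylMap.comp ?_ e1
    have := (CylMap.pow_shrink (u := [true]) a3.inv j).append (List.replicate (p + 1 - j) true)
    rwa [List.append_assoc, ← List.replicate_add, Nat.add_sub_cancel' hj] at this
  have m1 := mul_mem (inv_mem h1S) (pow_mem h0S (p + 2))
  have hX := mul_mem (pow_mem (inv_mem h0S) (p + 1)) m1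
  have p1 : Joins S (fun f => L ≤ 2 * wlen S f) (p + 2) (A⁻¹ * y ^ m * A)
      (x0 ^ (p + 2) * (A⁻¹ * y ^ m * A)) :=
    Joins.letter_pow (Or.inl h0) (p + 2) fun i _ => far _ (pow_mem h0S i) _ (e0 i)
  have p2 : Joins S (fun f => L ≤ 2 * wlen S f) 1 (x0 ^ (p + 2) * (A⁻¹ * y ^ m * A))
      (x1⁻¹ * (x0 ^ (p + 2) * (A⁻¹ * y ^ m * A))) := by
    refine Joins.letter (Or.inr (by rwa [inv_inv])) (far _ (pow_mem h0S _) _ (e0 _)) ?_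
    rw [← mul_assoc]
    exact far _ m1 _ e1
  have p3 : Joins S (fun f => L ≤ 2 * wlen S f) (p + 1)
      (x1⁻¹ * (x0 ^ (p + 2) * (A⁻¹ * y ^ m * A)))
      (x0⁻¹ ^ (p + 1) * (x1⁻¹ * (x0 ^ (p + 2) * (A⁻¹ * y ^ m * A)))) := by
    refine Joins.letter_pow (Or.inr (by rwa [inv_inv])) (p + 1) fun i hi => ?_
    have := far _ (mul_mem (pow_mem (inv_mem h0S) i) m1) _ (e2 i hi)
    simpa only [mul_assoc] using this
  have path := (p1.trans p2).trans p3
  rw [← mul_assoc x1⁻¹, ← mul_assoc (x0⁻¹ ^ (p + 1))] at path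
  have hlen := le_three_mul_wlen hS hx0 hx1 p hX
  have hfix := ((e2 (p + 1) le_rfl).append s)
  rw [Nat.sub_self] at hfix
  exact (Joins.of_commute path hR hX (hy.commute hAu hfix m) (by omega)).mono (by omega)

theorem Nbr_one_le : Nbr 1 ≤ 1 := by
  refine Nat.sInf_le ⟨{([], [])}, ⟨?_, ?_, ?_⟩, ?_, by simp⟩
  · intro ω
    exact ⟨([], []), ⟨by simp, ω, (app_nil ω).symm⟩, fun p hp => by simpa using hp.1⟩
  · intro ω
    exact ⟨([], []), ⟨by simp, ω, (app_nil ω).symm⟩, fun p hp => by simpa using hp.1⟩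
  · intro p hp ω
    obtain rfl : p = ([], []) := by simpa using hp
    rfl
  · intro u v h
    simp at h

theorem exists_joins_standard {x0 x1 c1 : VPerm} (hx0 : Represents x0 x0T)
    (hx1 : Represents x1 x1T) (hc1 : Represents c1 c1T) {g : VPerm}
    (hg : g ∈ Subgroup.closure {x0, x1, c1}) (hL : 1 ≤ wlen {x0, x1, c1} g) :
    Joins {x0, x1, c1} (fun f => wlen {x0, x1, c1} g ≤ 2 * wlen {x0, x1, c1} f)
      (100000000 * wlen {x0, x1, c1} g) g
      (x0 ^ (1 - ((10000000 * wlen {x0, x1, c1} g : ℕ) : ℤ)) * x1⁻¹ *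
        x0 ^ (10000000 * wlen {x0, x1, c1} g)) := by
  have hS := tame_gens hx0 hx1 hc1
  have h0 : x0 ∈ ({x0, x1, c1} : Set VPerm) := by simp
  have h1 : x1 ∈ ({x0, x1, c1} : Set VPerm) := by simp
  have hc : c1 ∈ ({x0, x1, c1} : Set VPerm) := by simp
  generalize ({x0, x1, c1} : Set VPerm) = S at *
  have hy := isSlide hx0 hx1
  have h0S : x0 ∈ Subgroup.closure S := Subgroup.subset_closure h0
  have h1S : x1 ∈ Subgroup.closure S := Subgroup.subset_closure h1
  have hcS : c1⁻¹ ∈ Subgroup.closure S := inv_mem (Subgroup.subset_closure hc)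
  have hyS : x0⁻¹ * x1⁻¹ * (x0 * x0) ∈ Subgroup.closure S :=
    mul_mem (mul_mem (inv_mem h0S) (inv_mem h1S)) (mul_mem h0S h0S)
  have hy4 : wlen S (x0⁻¹ * x1⁻¹ * (x0 * x0)) ≤ 4 := by
    have := wlen_prod_le (S := S) (l := [x0⁻¹, x1⁻¹, x0, x0]) (by simp [h0, h1])
    simpa [mul_assoc] using this
  obtain ⟨A, hA, u, hu, hAu, hA1, hA2, q1⟩ := exists_joins_cylMap hS hx0 hc1 h0 hc hg hL
  generalize wlen S g = L at *
  generalize x0⁻¹ * x1⁻¹ * (x0 * x0) = y at *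
  have q2 := hy.joins_conj hS hyS hy4 hA hAu hL hA1 hA2
  obtain ⟨p, hp⟩ : ∃ p, 10000000 * L = p + 2 := ⟨10000000 * L - 2, by omega⟩
  have htarget : x0 ^ (1 - ((10000000 * L : ℕ) : ℤ)) * x1⁻¹ * x0 ^ (10000000 * L) =
      x0⁻¹ ^ (p + 1) * (x1⁻¹ * x0 ^ (p + 2)) := by
    rw [hp, show (1 - ((p + 2 : ℕ) : ℤ)) = -((p + 1 : ℕ) : ℤ) by push_cast; ring, zpow_neg,
      zpow_natCast, inv_pow, mul_assoc]
  rw [htarget]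
  match u, hu, hAu with
  | true :: s, _, hAu =>
    have hlen := IsSlide.wlen_conj_le hyS hy4 hA (1000 * L)
    have q3 := hy.joins_standard hS hyS hA hx0 hx1 h0 h1 hAu (m := 1000 * L) (L := L) (p := p)
      (by omega) (by omega)
    exact ((q1.trans q2).trans q3).mono (by omega)
  | false :: s, _, hAu =>
    have q3 := hy.joins_conj_inv hS hyS hy4 hA hc1 hc hAu hL hA2
    have hlen := IsSlide.wlen_conj_le hyS hy4 hcS (100000 * L)
    have hletter := wlen_letter_le (S := S) (x := c1⁻¹) (Or.inr (by rwa [inv_inv]))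
    have hc10 : CylMap c1⁻¹ [true, false] [false] :=
      (hc1.cylMap (by decide : ([false], [true, false]) ∈ c1T)).inv
    have q4 := hy.joins_standard hS hyS hcS hx0 hx1 h0 h1 hc10 (m := 100000 * L) (L := L) (p := p)
      (by omega) (by omega)
    exact (((q1.trans q2).trans q3).trans q4).mono (by omega)

/-- There exist `δ, D > 0` and a positive integer `Q` such
that for every `g ∈ T` with `N(g) ≥ 4` there is a word `w` in the letters
`x0^{±1}, x1^{±1}, c1^{±1}` of length at most `D·|g|_B`, with
`g·w = x0^{Q|g|_B}·x1^{−1}·x0^{−Q|g|_B+1}` (left-to-right products), and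
`|g·w'|_B > δ·|g|_B` for every prefix `w'` of `w`. -/
theorem stmt15 (x0 x1 c1 : VPerm)
    (hx0 : Represents x0 x0T) (hx1 : Represents x1 x1T)
    (hc1 : Represents c1 c1T) :
    ∃ δ D : ℝ, ∃ Q : ℕ, 0 < δ ∧ 0 < D ∧ 0 < Q ∧
      ∀ g : VPerm, InT g → 4 ≤ Nbr g →
        ∃ w : List VPerm,
          (∀ x ∈ w, x = x0 ∨ x = x0⁻¹ ∨ x = x1 ∨ x = x1⁻¹ ∨ x = c1 ∨ x = c1⁻¹) ∧
          (w.length : ℝ) ≤ D * (wlen {x0, x1, c1} g : ℝ) ∧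
          wordEval g w =
            x0 ^ (1 - ((Q * wlen {x0, x1, c1} g : ℕ) : ℤ)) * x1⁻¹ *
              x0 ^ (Q * wlen {x0, x1, c1} g) ∧
          (∀ w' : List VPerm, w' <+: w →
            δ * (wlen {x0, x1, c1} g : ℝ) <
              (wlen {x0, x1, c1} (wordEval g w') : ℝ)) := by
  refine ⟨1 / 4, 100000000, 10000000, by norm_num, by norm_num, by norm_num, fun g hg hN => ?_⟩
  have hmem := mem_closure_of_inT hx0 hx1 hc1 hg
  have hL : 1 ≤ wlen {x0, x1, c1} g := by
    by_contra hlt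
    rw [eq_one_of_wlen_eq_zero hmem (by omega)] at hN
    have := Nbr_one_le
    omega
  obtain ⟨w, h1, h2, h3, h4⟩ := exists_joins_standard hx0 hx1 hc1 hmem hL
  refine ⟨w, fun x hx => ?_, by exact_mod_cast h2, h3, fun w' hw => ?_⟩
  · have := h1 x hx
    simp only [Set.mem_insert_iff, Set.mem_singleton_iff, inv_eq_iff_eq_inv] at this
    tauto
  · have k1 : (wlen {x0, x1, c1} g : ℝ) ≤ 2 * wlen {x0, x1, c1} (wordEval g w') := by
      exact_mod_cast h4 w' hw
    have k2 : (1 : ℝ) ≤ wlen {x0, x1, c1} g := by exact_mod_cast hL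
    linarith
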